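/- Let m = card ℬ. There exist exactly m weights μ₁,…,μ_m ∈ 𝔥* whose corresponding 𝔥-weight vectors ξ_{μ₁},…,ξ_{μ_m} ∈ S(𝔫)^𝔫 are prime elements of S(𝔫). These weights μ₁,…,μ_m are linearly independent, the elements ξ_{μ₁},…,ξ_{μ_m} are algebraically independent, and S(𝔫)^𝔫 = ℂ[ξ_{μ₁},…,ξ_{μ_m}] is a polynomial ring in m generators. Moreover there is a bijection ν ↦ (d₁(ν),…,d_m(ν)) from the set of 𝔥-weights occurring in S(𝔫)^𝔫 onto ℕ^m such that, up to a nonzero scalar, the weight vector of weight ν equals ξ_{μ₁}^{d₁(ν)} ⋯ ξ_{μ_m}^{d_m(ν)}, and this monomial is its prime factorization in S(𝔫). -/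

import Mathlib

open scoped InnerProductSpace BigOperators

structure RootSystemData (V : Type*) [NormedAddCommGroup V] [InnerProductSpace ℝ V] where
  Δ : Set V
  finite : Δ.Finite
  span_top : Submodule.span ℝ Δ = ⊤
  zero_not_mem : (0 : V) ∉ Δ
  neg_mem : ∀ α ∈ Δ, -α ∈ Δ
  reduced : ∀ α ∈ Δ, ∀ t : ℝ, t • α ∈ Δ → t = 1 ∨ t = -1
  crystal : ∀ α ∈ Δ, ∀ β ∈ Δ, ∃ n : ℤ, 2 * ⟪α, β⟫_ℝ = (n : ℝ) * ⟪β, β⟫_ℝ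
  reflect_mem : ∀ α ∈ Δ, ∀ β ∈ Δ, α - (2 * ⟪α, β⟫_ℝ / ⟪β, β⟫_ℝ) • β ∈ Δ
  Pos : Set V
  pos_subset : Pos ⊆ Δ
  mem_or_neg : ∀ α ∈ Δ, α ∈ Pos ∨ -α ∈ Pos
  not_neg_mem : ∀ α ∈ Pos, -α ∉ Pos
  pos_add : ∀ α ∈ Pos, ∀ β ∈ Pos, α + β ∈ Δ → α + β ∈ Pos

namespace RootSystemData

variable {V : Type*} [NormedAddCommGroup V] [InnerProductSpace ℝ V] (R : RootSystemData V)

/-- The set of simple roots: indecomposable positive roots. -/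
def Simple : Set V := {α ∈ R.Pos | ¬ ∃ β ∈ R.Pos, ∃ γ ∈ R.Pos, α = β + γ}

/-- The support `Π(φ)` of a positive root: the simple roots needed to express `φ`. -/
def support (φ : V) : Set V := {α ∈ R.Simple | φ ∉ Submodule.span ℝ (R.Simple \ {α})}

/-- The root subsystem `Δ(φ)`: all roots lying in the span of the support of `φ`. -/
def sub (φ : V) : Set V := {ψ ∈ R.Δ | ψ ∈ Submodule.span ℝ (R.support φ)}

/-- The positive roots `Δ(φ)₊` of the subsystem `Δ(φ)`. -/
def posSub (φ : V) : Set V := R.sub φ ∩ R.Pos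

/-- `x` is a nonnegative integer combination of positive roots. -/
def NonnegComb (x : V) : Prop :=
  ∃ c : V →₀ ℕ, ↑c.support ⊆ R.Pos ∧ x = c.sum fun α n => (n : ℝ) • α

/-- `β` is the highest root of the subset `S`. -/
def IsHighest (S : Set V) (β : V) : Prop :=
  β ∈ S ∧ β ∈ R.Pos ∧ ∀ ψ ∈ S, R.NonnegComb (β - ψ)

/-- `β` is locally high: it is the highest root of `Δ(β)`. -/
def LocallyHigh (β : V) : Prop := β ∈ R.Pos ∧ R.IsHighest (R.sub β) β

/-- `E(β) = {φ ∈ Δ(β) : (φ,β) > 0}`. -/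
def E (β : V) : Set V := {φ ∈ R.sub β | 0 < ⟪φ, β⟫_ℝ}

/-- `Δ(β)° = {φ ∈ Δ(β) : (φ,β) = 0}`. -/
def orth (β : V) : Set V := {φ ∈ R.sub β | ⟪φ, β⟫_ℝ = 0}

/-- Strong orthogonality of two roots. -/
def StronglyOrth (φ ψ : V) : Prop := φ + ψ ∉ R.Δ ∧ φ - ψ ∉ R.Δ

/-- Half the sum of the positive roots of `Δ(β)`. -/
noncomputable def rho (β : V) : V := (2⁻¹ : ℝ) • ∑ᶠ φ ∈ R.posSub β, φ

/-- The dual Coxeter number of `Δ(β)`, `⟨ρ_β, β^∨⟩ + 1`. -/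
noncomputable def dualCoxeter (β : V) : ℝ := 2 * ⟪R.rho β, β⟫_ℝ / ⟪β, β⟫_ℝ + 1

end RootSystemData

/-- A finite set of vectors is irreducible if it is nonempty and admits no splitting into
two nonempty mutually orthogonal pieces. -/
def IsIrred {V : Type*} [NormedAddCommGroup V] [InnerProductSpace ℝ V] (S : Set V) : Prop :=
  S.Nonempty ∧ ¬ ∃ A B : Set V, A ∪ B = S ∧ A ∩ B = ∅ ∧ A.Nonempty ∧ B.Nonempty ∧
    ∀ a ∈ A, ∀ b ∈ B, ⟪a, b⟫_ℝ = 0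

/-- `C` is an irreducible component of `S`. -/
def IsComponent {V : Type*} [NormedAddCommGroup V] [InnerProductSpace ℝ V]
    (S C : Set V) : Prop :=
  C ⊆ S ∧ IsIrred C ∧ ∀ a ∈ C, ∀ b ∈ S \ C, ⟪a, b⟫_ℝ = 0

/-- The reflection `s_β` in the (co)vector `β`. -/
noncomputable def reflectRoot {V : Type*} [NormedAddCommGroup V] [InnerProductSpace ℝ V]
    (β v : V) : V := v - (2 * ⟪v, β⟫_ℝ / ⟪β, β⟫_ℝ) • β

namespace RootSystemData

variable {V : Type*} [NormedAddCommGroup V] [InnerProductSpace ℝ V] (R : RootSystemData V)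

/-- A chain cascade: a nonempty list whose head is the highest root of an irreducible
component of `Δ`, and each subsequent entry is the highest root of an irreducible component
of `Δ(previous)°`. -/
def IsChainCascade (l : List V) : Prop :=
  l ≠ [] ∧
  (∀ b ∈ l.head?, ∃ C, IsComponent R.Δ C ∧ R.IsHighest C b) ∧
  l.Chain' fun γ δ => ∃ C, IsComponent (R.orth γ) C ∧ R.IsHighest C δ

/-- The cascade `ℬ` of roots: all positive roots belonging to some chain cascade. -/
def cascade : Set V := {β | ∃ l, R.IsChainCascade l ∧ β ∈ l}

/-- `l` is the chain cascade `C(φ)` associated to the positive root `φ`. -/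
def IsCascadeChainOf (φ : V) (l : List V) : Prop :=
  R.IsChainCascade l ∧ (∀ β ∈ l, φ ∈ R.sub β) ∧
  (∀ β ∈ l.dropLast, ⟪φ, β⟫_ℝ = 0) ∧ ∀ β ∈ l.getLast?, 0 < ⟪φ, β⟫_ℝ

end RootSystemData

section LieSetup

variable (V : Type*) [NormedAddCommGroup V] [InnerProductSpace ℝ V]
  (L : Type*) [LieRing L] [LieAlgebra ℂ L] [Module.Finite ℂ L]

/-- A triangular decomposition of a finite-dimensional complex semisimple Lie algebra `L`,
with Cartan subalgebra `H`, root system `Δ` (realized in the real inner product space `V`,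
the inner product being the one induced by the Killing form), chosen root vectors `e φ`,
and the projection `Φ : L → 𝔫₋` with kernel `𝔟 = 𝔥 ⊕ 𝔫`. -/
structure CascadeLieData extends RootSystemData V where
  /-- the root vectors `e_φ` -/
  e : V → L
  /-- the Cartan subalgebra `𝔥` -/
  H : LieSubalgebra ℂ L
  /-- the realization of `V` inside `𝔥*`: each `φ ∈ V` gives a functional on `𝔥` -/
  wt : V →ₗ[ℝ] (H →ₗ[ℂ] ℂ)
  wt_inj : Function.Injective wt
  e_ne : ∀ φ ∈ Δ, e φ ≠ 0
  indep : LinearIndependent ℂ fun φ : Δ => e (φ : V)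
  root_vec : ∀ x : H, ∀ φ ∈ Δ, ⁅(x : L), e φ⁆ = wt φ x • e φ
  bracket_add : ∀ φ ∈ Δ, ∀ ψ ∈ Δ, φ + ψ ∈ Δ →
    ∃ c : ℂ, c ≠ 0 ∧ ⁅e φ, e ψ⁆ = c • e (φ + ψ)
  bracket_zero : ∀ φ ∈ Δ, ∀ ψ ∈ Δ, φ + ψ ∉ Δ → φ + ψ ≠ 0 → ⁅e φ, e ψ⁆ = 0
  bracket_opp : ∀ φ ∈ Δ, ⁅e φ, e (-φ)⁆ ∈ H
  span_eq_top : H.toSubmodule ⊔ Submodule.span ℂ (e '' Δ) = ⊤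
  killing_pair : ∀ φ ∈ Δ, killingForm ℂ L (e φ) (e (-φ)) ≠ 0
  killing_orth : ∀ φ ∈ Δ, ∀ ψ ∈ Δ, φ + ψ ≠ 0 → killingForm ℂ L (e φ) (e ψ) = 0
  /-- the projection `Φ : 𝔤 → 𝔫₋` with kernel `𝔟` -/
  Φ : L →ₗ[ℂ] L
  Φ_neg : ∀ z ∈ Submodule.span ℂ (e '' (Neg.neg '' Pos)), Φ z = z
  Φ_b : ∀ z ∈ H.toSubmodule ⊔ Submodule.span ℂ (e '' Pos), Φ z = 0

end LieSetup

namespace CascadeLieData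

variable {V : Type*} [NormedAddCommGroup V] [InnerProductSpace ℝ V]
  {L : Type*} [LieRing L] [LieAlgebra ℂ L] [Module.Finite ℂ L]
  (C : CascadeLieData V L)

/-- The nilradical `𝔫 = ⊕_{φ∈Δ₊} 𝔤_φ`. -/
def nSub : Submodule ℂ L := Submodule.span ℂ (C.e '' C.Pos)

/-- The opposite nilradical `𝔫₋`. -/
def nMinus : Submodule ℂ L := Submodule.span ℂ (C.e '' (Neg.neg '' C.Pos))

/-- The Borel subalgebra `𝔟 = 𝔥 ⊕ 𝔫` (as a subspace). -/
def bSub : Submodule ℂ L := C.H.toSubmodule ⊔ C.nSub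

/-- `𝔯 = span{e_β : β ∈ ℬ}`. -/
def rSub : Submodule ℂ L := Submodule.span ℂ (C.e '' C.toRootSystemData.cascade)

/-- `𝔯₋ = span{e_{−β} : β ∈ ℬ}`. -/
def rMinus : Submodule ℂ L :=
  Submodule.span ℂ (C.e '' (Neg.neg '' C.toRootSystemData.cascade))

/-- `𝔯₋ˣ`: the elements of `𝔯₋` all of whose coefficients are nonzero. -/
def rMinusX : Set L :=
  {z | ∃ a : V → ℂ, (∀ β ∈ C.toRootSystemData.cascade, a β ≠ 0) ∧
    z = ∑ᶠ β ∈ C.toRootSystemData.cascade, a β • C.e (-β)}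

/-- `𝔰 = span{e_φ : φ ∈ Δ₊ \ ℬ}`. -/
def sSub : Submodule ℂ L :=
  Submodule.span ℂ (C.e '' (C.Pos \ C.toRootSystemData.cascade))

/-- `𝔰₋ = span{e_{−φ} : φ ∈ Δ₊ \ ℬ}`. -/
def sMinus : Submodule ℂ L :=
  Submodule.span ℂ (C.e '' (Neg.neg '' (C.Pos \ C.toRootSystemData.cascade)))

/-- `𝔰(β) = span{e_φ : φ ∈ E(β), φ ≠ β}`. -/
def sBeta (β : V) : Submodule ℂ L :=
  Submodule.span ℂ (C.e '' (C.toRootSystemData.E β \ {β}))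

/-- `𝔰(−β) = span{e_{−φ} : φ ∈ E(β), φ ≠ β}`. -/
def sBetaMinus (β : V) : Submodule ℂ L :=
  Submodule.span ℂ (C.e '' (Neg.neg '' (C.toRootSystemData.E β \ {β})))

/-- `𝔢(β) = span{e_φ : φ ∈ E(β)}`. -/
def eSub (β : V) : Submodule ℂ L := Submodule.span ℂ (C.e '' C.toRootSystemData.E β)

/-- `𝔤(β)`: the Lie subalgebra generated by the root spaces `𝔤_{±α}`, `α ∈ Π(β)`. -/
def gSub (β : V) : LieSubalgebra ℂ L :=
  LieSubalgebra.lieSpan ℂ L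
    (C.e '' C.toRootSystemData.support β ∪ C.e '' (Neg.neg '' C.toRootSystemData.support β))

end CascadeLieData

/-! ### Derivations of polynomial rings -/

/-- A last nonvanishing iterate of a locally nilpotent map. -/
theorem exists_last_iterate {A : Type*} [Zero A] {D : A → A} {f : A}
    (hnil : ∃ k, D^[k] f = 0) (hf : f ≠ 0) :
    ∃ k, D^[k] f ≠ 0 ∧ D^[k + 1] f = 0 := by
  classical
  obtain ⟨k, hk⟩ : ∃ k, Nat.find hnil = k + 1 :=
    Nat.exists_eq_succ_of_ne_zero fun h => hf (by simpa [h] using Nat.find_spec hnil)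
  exact ⟨k, Nat.find_min hnil (by omega), by simpa [hk] using Nat.find_spec hnil⟩

section LocallyNilpotent

variable {A : Type*} [CommRing A] [Algebra ℂ A]

theorem derivation_iterate_mul (D : Derivation ℂ A A) : ∀ (a b : ℕ) (f g : A),
    D^[a + 1] f = 0 → D^[b + 1] g = 0 →
      D^[a + b] (f * g) = ((a + b).choose a : A) * (D^[a] f * D^[b] g) := by
  intro a b
  induction hn : a + b generalizing a b with
  | zero =>
    obtain ⟨rfl, rfl⟩ : a = 0 ∧ b = 0 := by omega
    simp
  | succ n ih =>
    intro f g hf hg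
    have hsplit : D (f * g) = D f * g + f * D g := by
      rw [D.leibniz, smul_eq_mul, smul_eq_mul]; ring
    have hadd : ∀ (k : ℕ) (x y : A), D^[k] (x + y) = D^[k] x + D^[k] y :=
      fun k x y => iterate_map_add D k x y
    rw [Function.iterate_succ_apply, hsplit, hadd]
    rcases a with _ | a
    · obtain ⟨b, rfl⟩ : ∃ b', b = b' + 1 := ⟨n, by omega⟩
      have hf' : D f = 0 := hf
      have := ih 0 b (by omega) f (D g) hf hg
      simp [hf', this, iterate_map_zero]
    · rcases b with _ | b
      · have hg' : D g = 0 := hg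
        have := ih a 0 (by omega) (D f) g hf hg
        rw [this, hg']
        have h1 : n = a := by omega
        subst h1
        simp [iterate_map_zero]
      · have h1 := ih a (b + 1) (by omega) (D f) g hf hg
        have h2 := ih (a + 1) b (by omega) f (D g) hf hg
        rw [h1, h2, Nat.choose_succ_succ]
        push_cast
        simp only [Function.iterate_succ_apply]
        ring

theorem derivation_iterate_mul_eq_zero (D : Derivation ℂ A A) : ∀ (a b : ℕ) (f g : A),
    D^[a] f = 0 → D^[b] g = 0 → D^[a + b] (f * g) = 0 := by
  intro a b
  induction hn : a + b generalizing a b with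
  | zero =>
    obtain ⟨rfl, rfl⟩ : a = 0 ∧ b = 0 := by omega
    intro f g hf _
    simp only [Function.iterate_zero, id] at hf
    simp [hf]
  | succ n ih =>
    intro f g hf hg
    have hsplit : D (f * g) = D f * g + f * D g := by
      rw [D.leibniz, smul_eq_mul, smul_eq_mul]; ring
    rw [Function.iterate_succ_apply, hsplit, iterate_map_add D]
    rcases a with _ | a
    · simp only [Function.iterate_zero, id] at hf
      simp [hf, iterate_map_zero]
    · rcases b with _ | b
      · simp only [Function.iterate_zero, id] at hg
        simp [hg, iterate_map_zero]
      · rw [ih a (b + 1) (by omega) _ _ hf hg, ih (a + 1) b (by omega) _ _ hf hg, add_zero]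

theorem derivation_eq_zero_of_mul [IsDomain A] (D : Derivation ℂ A A)
    (hnil : ∀ f, ∃ k, D^[k] f = 0) {f g : A} (hfg : f * g ≠ 0) (h : D (f * g) = 0) :
    D f = 0 := by
  have : CharZero A := charZero_of_injective_algebraMap (algebraMap ℂ A).injective
  obtain ⟨a, ha, ha'⟩ := exists_last_iterate (hnil f) (left_ne_zero_of_mul hfg)
  obtain ⟨b, hb, hb'⟩ := exists_last_iterate (hnil g) (right_ne_zero_of_mul hfg)
  have key := derivation_iterate_mul D a b f g ha' hb'
  rcases a with _ | a
  · exact ha'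
  · exfalso
    have h0 : D^[a + 1 + b] (f * g) = 0 := by
      rw [show a + 1 + b = (a + b) + 1 by omega, Function.iterate_succ_apply, h, iterate_map_zero]
    rw [h0] at key
    refine mul_ne_zero ?_ (mul_ne_zero ha hb) key.symm
    exact_mod_cast (Nat.choose_pos (by omega)).ne'

theorem derivation_iterate_pow (D : Derivation ℂ A A) {s : A} (h : D (D s) = 0) (k : ℕ) :
    D^[k] (s ^ k) = (k.factorial : A) * D s ^ k ∧ D^[k + 1] (s ^ k) = 0 := by
  induction k with
  | zero => simp
  | succ k ih =>
    have h1 : D^[1 + 1] s = 0 := h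
    have h2 : D^[k + 1] (s ^ (k + 1)) = ((k + 1).factorial : A) * D s ^ (k + 1) := by
      rw [pow_succ, derivation_iterate_mul D k 1 _ _ ih.2 h1, ih.1, Nat.factorial_succ]
      simp only [Nat.choose_succ_self_right, Function.iterate_one]
      push_cast
      ring
    refine ⟨h2, ?_⟩
    rw [Function.iterate_succ_apply', h2, D.leibniz, D.leibniz_pow, h]
    simp

end LocallyNilpotent

/-! ### Actions on polynomial rings with cascade-like combinatorics -/

open MvPolynomial in
/-- The combinatorial features of the adjoint action of `𝔫` on `S(𝔫)` which determine its
invariants: the index set `P` plays the role of the positive roots, `w` records the weights, `D`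
the derivations, and `B` the cascade. -/
structure CascadeAction {P V : Type*} [AddCommGroup V] [Module ℝ V] (w : P → V)
    (D : P → Derivation ℂ (MvPolynomial P ℂ) (MvPolynomial P ℂ)) (B : Set P) : Prop where
  height : ∃ ℓ : V →ₗ[ℝ] ℝ, ∀ φ, 0 < ℓ (w φ)
  weight_injective : Function.Injective w
  apply_X_of_add : ∀ φ ψ χ, w χ = w φ + w ψ → ∃ c : ℂ, c ≠ 0 ∧ D φ (X ψ) = c • X χ
  apply_X_eq_zero : ∀ φ ψ, (∀ χ, w χ ≠ w φ + w ψ) → D φ (X ψ) = 0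
  commutator : ∀ φ ψ, ∃ (c : ℂ) (χ : P), (c = 0 ∨ w χ = w φ + w ψ) ∧
    ∀ f, D φ (D ψ f) = D ψ (D φ f) + c • D χ f
  partner : ∀ ψ ∉ B, ∃ ψ' ∉ B, ∃ β ∈ B, w β = w ψ + w ψ'
  partner_unique : ∀ ψ χ χ' β β', β ∈ B → β' ∈ B → w β = w ψ + w χ → w β' = w ψ + w χ' → χ = χ'
  add_ne : ∀ β ∈ B, ∀ φ, ∀ β' ∈ B, w β' ≠ w β + w φ
  weight_indep : LinearIndependent ℝ fun β : B => w β

open MvPolynomial in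
open Classical in
/-- The projection of a polynomial ring onto the polynomials in the variables from `B`. -/
noncomputable def restrictVars {P : Type*} (B : Set P) : MvPolynomial P ℂ →ₐ[ℂ] MvPolynomial B ℂ :=
  aeval fun φ => if h : φ ∈ B then X ⟨φ, h⟩ else 0

section restrictVars

open MvPolynomial

variable {P : Type*} {B : Set P}

theorem restrictVars_X_of_mem {φ : P} (h : φ ∈ B) : restrictVars B (X φ) = X ⟨φ, h⟩ := by
  simp [restrictVars, h]

theorem restrictVars_X_of_notMem {φ : P} (h : φ ∉ B) : restrictVars B (X φ) = 0 := by
  simp [restrictVars, h]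

theorem constantCoeff_restrictVars (f : MvPolynomial P ℂ) :
    constantCoeff (restrictVars B f) = constantCoeff f := by
  induction f using MvPolynomial.induction_on with
  | C a => simp
  | add p q hp hq => simp [hp, hq]
  | mul_X p φ _ =>
    by_cases h : φ ∈ B
    · simp [restrictVars_X_of_mem h]
    · simp [restrictVars_X_of_notMem h]

theorem restrictVars_pderiv (β : B) (f : MvPolynomial P ℂ) :
    restrictVars B (pderiv (β : P) f) = pderiv β (restrictVars B f) := by
  classical
  induction f using MvPolynomial.induction_on with
  | C a => simp
  | add p q hp hq => simp [hp, hq]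
  | mul_X p φ hp =>
    by_cases h : φ ∈ B
    · simp only [Derivation.leibniz, map_add, smul_eq_mul, map_mul, hp, restrictVars_X_of_mem h,
        pderiv_X]
      congr 2
      by_cases hφ : φ = β
      · subst hφ; simp
      · have : (⟨φ, h⟩ : B) ≠ β := fun hc => hφ (congrArg Subtype.val hc)
        simp [hφ, this]
    · have : φ ≠ β := fun hc => h (hc ▸ β.2)
      simp [restrictVars_X_of_notMem h, pderiv_X, hp, this]

theorem derivation_eq_sum_pderiv [Fintype P]
    (D : Derivation ℂ (MvPolynomial P ℂ) (MvPolynomial P ℂ)) (f : MvPolynomial P ℂ) :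
    D f = ∑ χ, pderiv χ f * D (X χ) := by
  classical
  have hsum : ∀ g, (∑ χ, D (X χ) • pderiv χ : Derivation ℂ (MvPolynomial P ℂ) _) g =
      ∑ χ, (D (X χ) • pderiv χ : Derivation ℂ (MvPolynomial P ℂ) _) g := fun g => by
    rw [← Derivation.coeFnAddMonoidHom_apply, map_sum, Finset.sum_apply]
    rfl
  have : D = ∑ χ, D (X χ) • pderiv χ := by
    refine derivation_ext fun φ => ?_
    rw [hsum, Finset.sum_eq_single φ]
    · simp
    · intro χ _ hχ
      simp [pderiv_X, hχ]
    · simp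
  conv_lhs => rw [this]
  rw [hsum]
  exact Finset.sum_congr rfl fun χ _ => by simp [mul_comm]

end restrictVars

namespace CascadeAction

open MvPolynomial

variable {P V : Type*} [Fintype P] [AddCommGroup V] [Module ℝ V] {w : P → V}
  {D : P → Derivation ℂ (MvPolynomial P ℂ) (MvPolynomial P ℂ)} {B : Set P}

theorem restrict_apply_of_mem (h : CascadeAction w D B) {β : P} (hβ : β ∈ B)
    (f : MvPolynomial P ℂ) : restrictVars B (D β f) = 0 := by
  rw [derivation_eq_sum_pderiv, map_sum]
  refine Finset.sum_eq_zero fun χ _ => ?_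
  by_cases hχ : ∃ τ, w τ = w β + w χ
  · obtain ⟨τ, hτ⟩ := hχ
    obtain ⟨c, -, hc⟩ := h.apply_X_of_add _ _ _ hτ
    rw [hc, map_mul, map_smul, restrictVars_X_of_notMem, smul_zero, mul_zero]
    exact fun hτB => h.add_ne β hβ χ τ hτB hτ
  · rw [h.apply_X_eq_zero _ _ (not_exists.mp hχ), mul_zero, map_zero]

theorem restrict_pderiv_of_notMem (h : CascadeAction w D B) {χ : P} (hχ : χ ∉ B) :
    ∃ (ψ : P) (β : B) (c : ℂ), c ≠ 0 ∧ ∀ f,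
      restrictVars B (D ψ f) = c • (X β * restrictVars B (pderiv χ f)) := by
  obtain ⟨ψ, hψ, β, hβ, hadd⟩ := h.partner χ hχ
  rw [add_comm] at hadd
  obtain ⟨c, hc, hX⟩ := h.apply_X_of_add _ _ _ hadd
  refine ⟨ψ, ⟨β, hβ⟩, c, hc, fun f => ?_⟩
  rw [derivation_eq_sum_pderiv, map_sum, Finset.sum_eq_single χ]
  · rw [hX, map_mul, map_smul, restrictVars_X_of_mem hβ, mul_smul_comm, mul_comm]
  · intro χ' _ hne
    by_cases hχ : ∃ τ, w τ = w ψ + w χ'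
    · obtain ⟨τ, hτ⟩ := hχ
      obtain ⟨c, -, hc⟩ := h.apply_X_of_add _ _ _ hτ
      rw [hc, map_mul, map_smul, restrictVars_X_of_notMem, smul_zero, mul_zero]
      exact fun hτB => hne (h.partner_unique _ _ _ _ _ hτB hβ hτ hadd)
    · rw [h.apply_X_eq_zero _ _ (not_exists.mp hχ), mul_zero, map_zero]
  · simp

theorem commutator_pderiv (h : CascadeAction w D B) (ψ χ : P) :
    ∃ (c : ℂ) (τ : P), ∀ f, D ψ (pderiv χ f) = pderiv χ (D ψ f) + c • pderiv τ f := by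
  classical
  suffices H : ∃ (c : ℂ) (τ : P), ⁅D ψ, (pderiv χ : Derivation ℂ (MvPolynomial P ℂ) _)⁆
      = c • pderiv τ by
    obtain ⟨c, τ, H⟩ := H
    refine ⟨c, τ, fun f => ?_⟩
    have := DFunLike.congr_fun H f
    rw [Derivation.commutator_apply] at this
    rw [← sub_eq_iff_eq_add', this]
    rfl
  have hconst : ∀ κ, D ψ (pderiv χ (X κ)) = 0 := by
    intro κ
    rw [pderiv_X, Pi.single_apply]
    split_ifs <;> simp
  by_cases hτ : ∃ τ, w χ = w ψ + w τ
  · obtain ⟨τ, hτ⟩ := hτ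
    obtain ⟨c, -, hc⟩ := h.apply_X_of_add _ _ _ hτ
    refine ⟨-c, τ, derivation_ext fun κ => ?_⟩
    rw [Derivation.commutator_apply, hconst, zero_sub, Derivation.smul_apply, neg_smul]
    congr 1
    by_cases hκ : κ = τ
    · subst hκ; rw [hc]; simp
    · rw [pderiv_X_of_ne hκ, smul_zero]
      by_cases hκ' : ∃ σ, w σ = w ψ + w κ
      · obtain ⟨σ, hσ⟩ := hκ'
        obtain ⟨c', -, hc'⟩ := h.apply_X_of_add _ _ _ hσ
        have : σ ≠ χ := by
          rintro rfl
          exact hκ (h.weight_injective (add_left_cancel (hσ.symm.trans hτ)))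
        simp [hc', pderiv_X_of_ne this]
      · rw [h.apply_X_eq_zero _ _ (not_exists.mp hκ'), map_zero]
  · refine ⟨0, ψ, derivation_ext fun κ => ?_⟩
    rw [Derivation.commutator_apply, hconst, zero_sub, zero_smul, Derivation.zero_apply,
      neg_eq_zero]
    by_cases hκ' : ∃ σ, w σ = w ψ + w κ
    · obtain ⟨σ, hσ⟩ := hκ'
      obtain ⟨c', -, hc'⟩ := h.apply_X_of_add _ _ _ hσ
      have : σ ≠ χ := by
        rintro rfl
        exact hτ ⟨κ, hσ⟩
      simp [hc', pderiv_X_of_ne this]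
    · rw [h.apply_X_eq_zero _ _ (not_exists.mp hκ'), map_zero]

/-- An `𝔫`-stable subspace of `S(𝔫)` vanishing on `𝔯₋` is zero. -/
theorem eq_zero_of_stable (h : CascadeAction w D B) (U : Submodule ℂ (MvPolynomial P ℂ))
    (hU : ∀ φ, ∀ f ∈ U, D φ f ∈ U) (hρ : ∀ f ∈ U, restrictVars B f = 0) : ∀ f ∈ U, f = 0 := by
  suffices H : ∀ (n : ℕ) (U : Submodule ℂ (MvPolynomial P ℂ)), (∀ φ, ∀ f ∈ U, D φ f ∈ U) →
      (∀ f ∈ U, restrictVars B f = 0) → ∀ f ∈ U, ∀ d : P →₀ ℕ, d.degree = n → coeff d f = 0 from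
    fun f hf => MvPolynomial.ext _ _ fun d => by simpa using H _ U hU hρ f hf d rfl
  clear! U
  intro n
  induction n with
  | zero =>
    intro U _ hρ f hf d hd
    rw [Finsupp.degree_eq_zero_iff] at hd
    subst hd
    rw [← constantCoeff_eq, ← constantCoeff_restrictVars (B := B), hρ f hf, map_zero]
  | succ n ih =>
    intro U hU hρ f hf d hd
    obtain ⟨χ, hχ⟩ : ∃ χ, d χ ≠ 0 := by
      by_contra! hc
      have : d = 0 := Finsupp.ext hc
      simp [this] at hd
    set U' : Submodule ℂ (MvPolynomial P ℂ) := U ⊔ ⨆ τ, U.map (pderiv τ).toLinearMap with hU'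
    have hmem : ∀ τ, ∀ g ∈ U, pderiv τ g ∈ U' := fun τ g hg =>
      Submodule.mem_sup_right <| Submodule.mem_iSup_of_mem τ <| Submodule.mem_map_of_mem hg
    have hstable : ∀ φ, U' ≤ U'.comap (D φ).toLinearMap := by
      intro φ
      refine sup_le (fun g hg => Submodule.mem_sup_left (hU φ g hg)) (iSup_le fun τ => ?_)
      rintro _ ⟨g, hg, rfl⟩
      obtain ⟨c, σ, hc⟩ := h.commutator_pderiv φ τ
      change D φ (pderiv τ g) ∈ U'
      rw [hc]
      exact U'.add_mem (hmem _ _ (hU φ g hg)) (U'.smul_mem _ (hmem _ _ hg))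
    have hker : U' ≤ LinearMap.ker (restrictVars B).toLinearMap := by
      refine sup_le (fun g hg => hρ g hg) (iSup_le fun τ => ?_)
      rintro _ ⟨g, hg, rfl⟩
      change restrictVars B (pderiv τ g) = 0
      by_cases hτ : τ ∈ B
      · rw [restrictVars_pderiv ⟨τ, hτ⟩, hρ g hg, map_zero]
      · obtain ⟨ψ, β, c, hc, H⟩ := h.restrict_pderiv_of_notMem hτ
        have := H g
        rw [hρ _ (hU ψ g hg), eq_comm, smul_eq_zero_iff_right hc] at this
        exact (mul_eq_zero.mp this).resolve_left (X_ne_zero _)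
    have hle : Finsupp.single χ 1 ≤ d := by
      rw [Finsupp.single_le_iff]; omega
    have hd' : (d - Finsupp.single χ 1) + Finsupp.single χ 1 = d := tsub_add_cancel_of_le hle
    have hdeg : (d - Finsupp.single χ 1).degree = n := by
      have := congrArg Finsupp.degree hd'
      rw [map_add, Finsupp.degree_single, hd] at this
      omega
    have := ih U' (fun φ g hg => hstable φ hg) (fun g hg => hker hg) _ (hmem χ f hf) _ hdeg
    rw [coeff_pderiv, hd'] at this
    exact (mul_eq_zero.mp this).resolve_right (Nat.cast_add_one_ne_zero _)

end CascadeAction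

section weights

open MvPolynomial

theorem map_weightedHomogeneousComponent {σ τ V : Type*} [AddCommGroup V] {w : σ → V} {w' : τ → V}
    (T : MvPolynomial σ ℂ →ₗ[ℂ] MvPolynomial τ ℂ) {g : V → V} (hg : Function.Injective g)
    (hT : ∀ d, IsWeightedHomogeneous w' (T (monomial d 1)) (g (Finsupp.weight w d)))
    (ν : V) (f : MvPolynomial σ ℂ) :
    T (weightedHomogeneousComponent w ν f) = weightedHomogeneousComponent w' (g ν) (T f) := by
  induction f using MvPolynomial.induction_on' with
  | add p q hp hq => simp [hp, hq]
  | monomial d c =>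
    have hd : IsWeightedHomogeneous w (monomial d c) (Finsupp.weight w d) :=
      isWeightedHomogeneous_monomial _ _ _ rfl
    have hTd : IsWeightedHomogeneous w' (T (monomial d c)) (g (Finsupp.weight w d)) := by
      have : (monomial d c : MvPolynomial σ ℂ) = c • monomial d 1 := by simp [smul_monomial]
      rw [this, map_smul]
      exact (weightedHomogeneousSubmodule ℂ w' _).smul_mem c (hT d)
    by_cases hν : Finsupp.weight w d = ν
    · subst hν
      rw [hd.weightedHomogeneousComponent_same, hTd.weightedHomogeneousComponent_same]
    · rw [hd.weightedHomogeneousComponent_ne _ (Ne.symm hν),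
        hTd.weightedHomogeneousComponent_ne _ (hg.ne (Ne.symm hν)), map_zero]

theorem restrictVars_weightedHomogeneousComponent {P V : Type*} [AddCommGroup V] (w : P → V)
    (B : Set P) (ν : V) (f : MvPolynomial P ℂ) :
    restrictVars B (weightedHomogeneousComponent w ν f) =
      weightedHomogeneousComponent (fun β : B => w β) ν (restrictVars B f) := by
  refine map_weightedHomogeneousComponent (g := id) (restrictVars B).toLinearMap
    Function.injective_id (fun d => ?_) ν f
  rw [monomial_eq, AlgHom.toLinearMap_apply, map_mul, restrictVars, aeval_C, map_one, one_mul,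
    Finsupp.prod, map_prod, id, Finsupp.weight_apply, Finsupp.sum]
  refine IsWeightedHomogeneous.prod _ _ _ fun φ _ => ?_
  rw [map_pow, aeval_X]
  refine IsWeightedHomogeneous.pow ?_ _
  split_ifs with h
  · exact isWeightedHomogeneous_X _ _ _
  · exact isWeightedHomogeneous_zero _ _ _

theorem restrictVars_eq_monomial_of_mul {P : Type*} {B : Set P} {f g : MvPolynomial P ℂ}
    {d : B →₀ ℕ} {c : ℂ} (hc : c ≠ 0) (hd : restrictVars B (f * g) = monomial d c) :
    ∃ e a, a ≠ 0 ∧ restrictVars B f = monomial e a := by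
  have hdvd : restrictVars B f ∣ monomial d c := ⟨restrictVars B g, by rw [← map_mul, hd]⟩
  rw [dvd_monomial_iff_exists hc] at hdvd
  obtain ⟨e, a, -, ha, he⟩ := hdvd
  exact ⟨e, a, ne_zero_of_dvd_ne_zero hc ha, he⟩

end weights

/-- The subalgebra of polynomials killed by the derivations indexed by `T`. -/
def killedBy {P A : Type*} [CommRing A] [Algebra ℂ A] (D : P → Derivation ℂ A A) (T : Set P) :
    Subalgebra ℂ A where
  carrier := {f | ∀ φ ∈ T, D φ f = 0}
  mul_mem' hf hg φ hφ := by simp [hf φ hφ, hg φ hφ]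
  add_mem' hf hg φ hφ := by simp [hf φ hφ, hg φ hφ]
  algebraMap_mem' c φ _ := by simp

theorem mem_killedBy {P A : Type*} [CommRing A] [Algebra ℂ A] {D : P → Derivation ℂ A A}
    {T : Set P} {f : A} : f ∈ killedBy D T ↔ ∀ φ ∈ T, D φ f = 0 := Iff.rfl

namespace CascadeAction

open MvPolynomial

variable {P V : Type*} [Fintype P] [AddCommGroup V] [Module ℝ V] {w : P → V}
  {D : P → Derivation ℂ (MvPolynomial P ℂ) (MvPolynomial P ℂ)} {B : Set P}

theorem exists_iterate_eq_zero (h : CascadeAction w D B) (φ : P) (f : MvPolynomial P ℂ) :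
    ∃ k, (D φ)^[k] f = 0 := by
  obtain ⟨ℓ, hℓ⟩ := h.height
  have hsmul : ∀ (k : ℕ) (c : ℂ) g, (D φ)^[k] (c • g) = c • (D φ)^[k] g := by
    intro k
    induction k with
    | zero => simp
    | succ k ih => intro c g; simp only [Function.iterate_succ_apply, Derivation.map_smul, ih]
  have hX : ∀ ψ, ∃ k, (D φ)^[k] (X ψ) = 0 := by
    intro ψ
    have wf : WellFounded fun a b : P => ℓ (w b) < ℓ (w a) := by
      have : IsTrans P fun a b => ℓ (w b) < ℓ (w a) := ⟨fun a b c hab hbc => hbc.trans hab⟩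
      have : Std.Irrefl fun a b : P => ℓ (w b) < ℓ (w a) := ⟨fun a => lt_irrefl _⟩
      exact Finite.wellFounded_of_trans_of_irrefl _
    induction ψ using wf.induction with
    | _ ψ ih =>
      by_cases hχ : ∃ χ, w χ = w φ + w ψ
      · obtain ⟨χ, hχ⟩ := hχ
        obtain ⟨c, -, hc⟩ := h.apply_X_of_add _ _ _ hχ
        obtain ⟨k, hk⟩ := ih χ (by rw [hχ, map_add]; linarith [hℓ φ])
        exact ⟨k + 1, by rw [Function.iterate_succ_apply, hc, hsmul, hk, smul_zero]⟩
      · exact ⟨1, h.apply_X_eq_zero _ _ (not_exists.mp hχ)⟩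
  have hle : ∀ {k l : ℕ} {g : MvPolynomial P ℂ}, k ≤ l → (D φ)^[k] g = 0 → (D φ)^[l] g = 0 := by
    intro k l g hkl hk
    obtain ⟨r, rfl⟩ := Nat.exists_eq_add_of_le' hkl
    rw [Function.iterate_add_apply, hk, iterate_map_zero]
  induction f using MvPolynomial.induction_on with
  | C a => exact ⟨1, derivation_C _ _⟩
  | add p q hp hq =>
    obtain ⟨k, hk⟩ := hp
    obtain ⟨l, hl⟩ := hq
    exact ⟨k + l, by rw [iterate_map_add, hle (by omega) hk, hle (by omega) hl, add_zero]⟩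
  | mul_X p ψ hp =>
    obtain ⟨k, hk⟩ := hp
    obtain ⟨l, hl⟩ := hX ψ
    exact ⟨k + l, derivation_iterate_mul_eq_zero _ _ _ _ _ hk hl⟩

theorem eq_zero_of_restrict_eq_zero (h : CascadeAction w D B) {f : MvPolynomial P ℂ}
    (hf : f ∈ killedBy D Set.univ) (hρ : restrictVars B f = 0) : f = 0 := by
  refine h.eq_zero_of_stable (Submodule.span ℂ {f}) ?_ ?_ f (Submodule.mem_span_singleton_self f)
  · intro φ g hg
    obtain ⟨c, rfl⟩ := Submodule.mem_span_singleton.mp hg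
    rw [Derivation.map_smul, hf φ (Set.mem_univ φ), smul_zero]
    exact Submodule.zero_mem _
  · intro g hg
    obtain ⟨c, rfl⟩ := Submodule.mem_span_singleton.mp hg
    rw [map_smul, hρ, smul_zero]

theorem eq_of_restrict_eq (h : CascadeAction w D B) {f g : MvPolynomial P ℂ}
    (hf : f ∈ killedBy D Set.univ) (hg : g ∈ killedBy D Set.univ)
    (hρ : restrictVars B f = restrictVars B g) : f = g :=
  sub_eq_zero.mp <| h.eq_zero_of_restrict_eq_zero (sub_mem hf hg) (by rw [map_sub, hρ, sub_self])

theorem mem_killedBy_of_mul (h : CascadeAction w D B) {f g : MvPolynomial P ℂ} (hfg : f * g ≠ 0)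
    (hmem : f * g ∈ killedBy D Set.univ) : f ∈ killedBy D Set.univ := fun φ hφ =>
  derivation_eq_zero_of_mul (D φ) (h.exists_iterate_eq_zero φ) hfg (hmem φ hφ)

theorem apply_weightedHomogeneousComponent (h : CascadeAction w D B) (φ : P) (ν : V)
    (f : MvPolynomial P ℂ) :
    D φ (weightedHomogeneousComponent w ν f) =
      weightedHomogeneousComponent w (ν + w φ) (D φ f) := by
  refine map_weightedHomogeneousComponent (g := (· + w φ)) (D φ).toLinearMap
    (add_left_injective _) (fun d => ?_) ν f
  change IsWeightedHomogeneous w (D φ (monomial d 1)) _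
  rw [derivation_eq_sum_pderiv]
  refine (weightedHomogeneousSubmodule ℂ w _).sum_mem fun χ _ => ?_
  rw [mem_weightedHomogeneousSubmodule]
  by_cases hχ : d χ = 0
  · simp only [pderiv_monomial, hχ, Nat.cast_zero, mul_zero, monomial_zero, zero_mul]
    exact isWeightedHomogeneous_zero _ _ _
  have hd : (d - Finsupp.single χ 1) + Finsupp.single χ 1 = d :=
    tsub_add_cancel_of_le (by rw [Finsupp.single_le_iff]; omega)
  have hw : Finsupp.weight w d + w φ =
      Finsupp.weight w (d - Finsupp.single χ 1) + (w φ + w χ) := by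
    conv_lhs => rw [← hd]
    rw [map_add, Finsupp.weight_single, one_smul]
    abel
  change IsWeightedHomogeneous w _ (Finsupp.weight w d + w φ)
  rw [hw]
  refine IsWeightedHomogeneous.mul ?_ ?_
  · rw [pderiv_monomial]
    exact isWeightedHomogeneous_monomial _ _ _ rfl
  · by_cases hτ : ∃ τ, w τ = w φ + w χ
    · obtain ⟨τ, hτ⟩ := hτ
      obtain ⟨c, -, hc⟩ := h.apply_X_of_add _ _ _ hτ
      rw [hc, ← hτ]
      exact (weightedHomogeneousSubmodule ℂ w _).smul_mem c (isWeightedHomogeneous_X _ _ _)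
    · rw [h.apply_X_eq_zero _ _ (not_exists.mp hτ)]
      exact isWeightedHomogeneous_zero _ _ _

theorem weightedHomogeneousComponent_mem (h : CascadeAction w D B) (ν : V) {f : MvPolynomial P ℂ}
    (hf : f ∈ killedBy D Set.univ) :
    weightedHomogeneousComponent w ν f ∈ killedBy D Set.univ := fun φ hφ => by
  rw [h.apply_weightedHomogeneousComponent, hf φ hφ, map_zero]

theorem weight_finsupp_injective (h : CascadeAction w D B) :
    Function.Injective (Finsupp.weight (fun β : B => w β) : (B →₀ ℕ) → V) := by
  classical
  intro d e hde
  have key : ∀ d : B →₀ ℕ, Finsupp.weight (fun β : B => w β) d =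
      ∑ β, ((d β : ℕ) : ℝ) • w β := by
    intro d
    rw [Finsupp.weight_apply, Finsupp.sum_fintype _ _ (by simp)]
    simp [Nat.cast_smul_eq_nsmul]
  rw [key, key] at hde
  have := Fintype.linearIndependent_iffₛ.mp h.weight_indep _ _ hde
  exact Finsupp.ext fun β => by exact_mod_cast this β

/-- A weighted homogeneous invariant restricts to a multiple of a monomial. -/
theorem restrict_eq_monomial (h : CascadeAction w D B) {ν : V} {f : MvPolynomial P ℂ}
    (hf : IsWeightedHomogeneous w f ν) : ∃ d c, restrictVars B f = monomial d c := by
  classical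
  have hρ : IsWeightedHomogeneous (fun β : B => w β) (restrictVars B f) ν := by
    have := restrictVars_weightedHomogeneousComponent w B ν f
    rw [hf.weightedHomogeneousComponent_same] at this
    rw [this]
    exact weightedHomogeneousComponent_isWeightedHomogeneous _ _
  by_cases h0 : restrictVars B f = 0
  · exact ⟨0, 0, by rw [h0, monomial_zero]⟩
  obtain ⟨d, hd⟩ := ne_zero_iff.mp h0
  refine ⟨d, coeff d (restrictVars B f), MvPolynomial.ext _ _ fun e => ?_⟩
  rw [coeff_monomial]
  split_ifs with hde
  · rw [hde]
  · by_contra he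
    exact hde (h.weight_finsupp_injective ((hρ hd).trans (hρ he).symm))

/-- An invariant restricting to a monomial is weighted homogeneous. -/
theorem isWeightedHomogeneous_of_restrict (h : CascadeAction w D B) {f : MvPolynomial P ℂ}
    (hf : f ∈ killedBy D Set.univ) {d : B →₀ ℕ} {c : ℂ} (hd : restrictVars B f = monomial d c) :
    IsWeightedHomogeneous w f (Finsupp.weight (fun β : B => w β) d) := by
  have : weightedHomogeneousComponent w (Finsupp.weight (fun β : B => w β) d) f = f := by
    refine h.eq_of_restrict_eq (h.weightedHomogeneousComponent_mem _ hf) hf ?_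
    rw [restrictVars_weightedHomogeneousComponent, hd]
    exact (isWeightedHomogeneous_monomial _ _ _ rfl).weightedHomogeneousComponent_same
  rw [← this]
  exact weightedHomogeneousComponent_isWeightedHomogeneous _ _

end CascadeAction

section monomials

open MvPolynomial

theorem aeval_monomial_one {ι σ : Type*} (v : ι → σ →₀ ℕ) (p : MvPolynomial ι ℂ) :
    aeval (fun i => (monomial (v i) (1 : ℂ))) p =
      ∑ n ∈ p.support, monomial (Finsupp.linearCombination ℕ v n) (coeff n p) := by
  rw [aeval_def, eval₂_eq]
  refine Finset.sum_congr rfl fun n _ => ?_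
  have : ∏ i ∈ n.support, (monomial (v i) (1 : ℂ)) ^ n i =
      monomial (Finsupp.linearCombination ℕ v n) 1 := by
    simp only [monomial_pow, one_pow]
    rw [Finsupp.linearCombination_apply, Finsupp.sum, monomial_sum_one]
  rw [this, algebraMap_eq, C_mul_monomial, mul_one]

theorem algebraicIndependent_monomial {ι σ : Type*} {v : ι → σ →₀ ℕ}
    (hv : LinearIndependent ℕ v) : AlgebraicIndependent ℂ fun i => monomial (v i) (1 : ℂ) := by
  classical
  rw [algebraicIndependent_iff]
  intro p hp
  rw [aeval_monomial_one] at hp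
  ext m
  have := congrArg (coeff (Finsupp.linearCombination ℕ v m)) hp
  rw [coeff_sum, coeff_zero] at this
  by_cases hm : m ∈ p.support
  · rw [Finset.sum_eq_single m] at this
    · simpa using this
    · intro n _ hn
      rw [coeff_monomial, if_neg (hv.ne hn)]
    · exact fun h => absurd hm h
  · simpa using hm

theorem linearIndependent_real_of_nat {ι σ : Type*} [Finite σ] {v : ι → σ →₀ ℕ}
    (hv : LinearIndependent ℕ v) : LinearIndependent ℝ fun i (s : σ) => ((v i s : ℕ) : ℝ) := by
  have hZ : LinearIndependent ℤ fun i (s : σ) => ((v i s : ℕ) : ℤ) := by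
    rw [linearIndependent_iff']
    intro t g hg i hi
    rw [linearIndependent_iff'ₛ] at hv
    have := hv t (fun i => (g i).toNat) (fun i => (-g i).toNat) ?_ i hi
    · omega
    · ext s
      have hs := congrFun hg s
      simp only [Finset.sum_apply, Pi.smul_apply, smul_eq_mul, Pi.zero_apply] at hs
      simp only [Finsupp.coe_finsetSum, Finsupp.coe_smul, Finset.sum_apply, Pi.smul_apply,
        smul_eq_mul]
      zify
      rw [← sub_eq_zero, ← Finset.sum_sub_distrib, ← hs]
      refine Finset.sum_congr rfl fun i _ => ?_
      rw [← sub_mul]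
      congr 1
      omega
  have := (linearIndependent_algebraMap_comp_iff (S := ℝ)).mpr hZ
  have hcast : (fun i => ⇑(algebraMap ℤ ℝ) ∘ fun s : σ => ((v i s : ℕ) : ℤ)) =
      fun i (s : σ) => ((v i s : ℕ) : ℝ) := by
    ext i s
    simp
  rwa [hcast] at this

end monomials

/-- The exponents of the restrictions of prime invariants. -/
def primeExponents {P : Type*} (D : P → Derivation ℂ (MvPolynomial P ℂ) (MvPolynomial P ℂ))
    (B : Set P) : Set (B →₀ ℕ) :=
  {d | ∃ f, Prime f ∧ f ∈ killedBy D Set.univ ∧ restrictVars B f = MvPolynomial.monomial d 1}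

/-- The prime invariant with prescribed restriction. -/
noncomputable def primeInvariant {P : Type*}
    {D : P → Derivation ℂ (MvPolynomial P ℂ) (MvPolynomial P ℂ)}
    {B : Set P} (d : primeExponents D B) : MvPolynomial P ℂ := d.2.choose

section primeInvariant

open MvPolynomial

variable {P : Type*} {D : P → Derivation ℂ (MvPolynomial P ℂ) (MvPolynomial P ℂ)} {B : Set P}

theorem prime_primeInvariant (d : primeExponents D B) : Prime (primeInvariant d) :=
  d.2.choose_spec.1

theorem primeInvariant_mem (d : primeExponents D B) : primeInvariant d ∈ killedBy D Set.univ :=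
  d.2.choose_spec.2.1

theorem restrictVars_primeInvariant (d : primeExponents D B) :
    restrictVars B (primeInvariant d) = monomial (d : B →₀ ℕ) 1 :=
  d.2.choose_spec.2.2

theorem eq_of_primeInvariant_dvd {d e : primeExponents D B}
    (hde : primeInvariant d ∣ primeInvariant e) : d = e := by
  obtain ⟨u, hu⟩ := (prime_primeInvariant d).associated_of_dvd (prime_primeInvariant e) hde
  obtain ⟨a, ha, hua⟩ := isUnit_iff_eq_C_of_isReduced.mp u.isUnit
  have := congrArg (restrictVars B) hu
  rw [hua, map_mul, restrictVars_primeInvariant, restrictVars_primeInvariant, ← algebraMap_eq,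
    AlgHom.commutes, algebraMap_eq, mul_comm, C_mul_monomial, mul_one,
    monomial_eq_monomial_iff] at this
  exact Subtype.ext (this.resolve_right fun h => ha.ne_zero h.1).1

theorem multiset_eq_of_prod_eq : ∀ s t : Multiset (primeExponents D B),
    (s.map primeInvariant).prod = (t.map primeInvariant).prod → s = t := by
  intro s
  induction s using Multiset.induction_on with
  | empty =>
    intro t ht
    by_contra hne
    obtain ⟨d, hd⟩ := Multiset.exists_mem_of_ne_zero (Ne.symm hne)
    refine (prime_primeInvariant d).not_isUnit (isUnit_of_dvd_one ?_)
    rw [Multiset.map_zero, Multiset.prod_zero] at ht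
    rw [ht]
    exact Multiset.dvd_prod (Multiset.mem_map_of_mem _ hd)
  | cons d s ih =>
    intro t ht
    rw [Multiset.map_cons, Multiset.prod_cons] at ht
    obtain ⟨e, he, hdvd⟩ := (prime_primeInvariant d).exists_mem_multiset_map_dvd
      (Dvd.intro _ ht)
    obtain rfl := eq_of_primeInvariant_dvd hdvd
    obtain ⟨t, rfl⟩ := Multiset.exists_cons_of_mem he
    rw [Multiset.map_cons, Multiset.prod_cons] at ht
    rw [ih t (mul_left_cancel₀ (prime_primeInvariant d).ne_zero ht)]

theorem restrictVars_multiset_prod (s : Multiset (primeExponents D B)) :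
    restrictVars B (s.map primeInvariant).prod =
      monomial (s.map ((↑) : primeExponents D B → B →₀ ℕ)).sum 1 := by
  induction s using Multiset.induction_on with
  | empty => simp
  | cons d s ih =>
    simp only [Multiset.map_cons, Multiset.prod_cons, Multiset.sum_cons, map_mul, ih,
      restrictVars_primeInvariant, monomial_mul, one_mul]

end primeInvariant

namespace CascadeAction

open MvPolynomial

variable {P V : Type*} [Fintype P] [AddCommGroup V] [Module ℝ V] {w : P → V}
  {D : P → Derivation ℂ (MvPolynomial P ℂ) (MvPolynomial P ℂ)} {B : Set P}

/-- A prime invariant restricting to a monomial is a multiple of some `primeInvariant`. -/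
theorem exists_eq_smul_primeInvariant (h : CascadeAction w D B) {f : MvPolynomial P ℂ}
    (hp : Prime f) (hf : f ∈ killedBy D Set.univ) {d : B →₀ ℕ} {c : ℂ} (hc : c ≠ 0)
    (hd : restrictVars B f = monomial d c) :
    ∃ e : primeExponents D B, d = e ∧ f = c • primeInvariant e := by
  have hρ : restrictVars B (c⁻¹ • f) = monomial d 1 := by
    rw [map_smul, hd, smul_monomial, smul_eq_mul, inv_mul_cancel₀ hc]
  have hp' : Prime (c⁻¹ • f) := by
    refine (Associated.prime_iff ?_).mp hp
    refine ⟨(Units.mk0 c⁻¹ (inv_ne_zero hc)).map (algebraMap ℂ (MvPolynomial P ℂ)).toMonoidHom, ?_⟩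
    rw [mul_comm]
    exact (Algebra.smul_def _ _).symm
  have hmem : d ∈ primeExponents D B := ⟨_, hp', Subalgebra.smul_mem _ hf _, hρ⟩
  refine ⟨⟨d, hmem⟩, rfl, ?_⟩
  rw [← h.eq_of_restrict_eq (Subalgebra.smul_mem _ hf c⁻¹) (primeInvariant_mem ⟨d, hmem⟩)
    (hρ.trans (restrictVars_primeInvariant ⟨d, hmem⟩).symm), smul_inv_smul₀ hc]

theorem exists_eq_smul_prod (h : CascadeAction w D B) {f : MvPolynomial P ℂ}
    (hf : f ∈ killedBy D Set.univ) {d : B →₀ ℕ} {c : ℂ} (hc : c ≠ 0)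
    (hd : restrictVars B f = monomial d c) :
    ∃ (s : Multiset (primeExponents D B)) (a : ℂ), a ≠ 0 ∧ f = a • (s.map primeInvariant).prod := by
  have h0 : f ≠ 0 := by
    rintro rfl
    rw [map_zero, eq_comm, monomial_eq_zero] at hd
    exact hc hd
  suffices H : f ≠ 0 → f ∈ killedBy D Set.univ →
      (∃ d c, c ≠ 0 ∧ restrictVars B f = monomial d c) → ∃ (s : Multiset (primeExponents D B))
        (a : ℂ), a ≠ 0 ∧ f = a • (s.map primeInvariant).prod from H h0 hf ⟨d, c, hc, hd⟩
  clear h0 hf hd hc c d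
  induction f using UniqueFactorizationMonoid.induction_on_prime with
  | h₁ => exact fun h0 => absurd rfl h0
  | h₂ x hx =>
    intro _ _ _
    obtain ⟨a, ha, rfl⟩ := isUnit_iff_eq_C_of_isReduced.mp hx
    exact ⟨0, a, ha.ne_zero, by simp [smul_eq_C_mul]⟩
  | h₃ g p hg hp ih =>
    rintro hne hmem ⟨d, c, hc, hd⟩
    obtain ⟨d₁, a₁, ha₁, hd₁⟩ := restrictVars_eq_monomial_of_mul hc hd
    obtain ⟨e, rfl, he⟩ := h.exists_eq_smul_primeInvariant hp
      (h.mem_killedBy_of_mul hne hmem) ha₁ hd₁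
    rw [mul_comm] at hd hne hmem
    obtain ⟨s, a, ha, hs⟩ := ih hg (h.mem_killedBy_of_mul hne hmem)
      (restrictVars_eq_monomial_of_mul hc hd)
    refine ⟨e ::ₘ s, a₁ * a, mul_ne_zero ha₁ ha, ?_⟩
    conv_lhs => rw [he, hs]
    rw [Multiset.map_cons, Multiset.prod_cons, smul_mul_smul_comm]

theorem linearIndependent_primeExponents (h : CascadeAction w D B) :
    LinearIndependent ℕ ((↑) : primeExponents D B → B →₀ ℕ) := by
  classical
  intro m n hmn
  have key : ∀ n : primeExponents D B →₀ ℕ,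
      (n.toMultiset.map ((↑) : primeExponents D B → B →₀ ℕ)).sum =
        Finsupp.linearCombination ℕ ((↑) : primeExponents D B → B →₀ ℕ) n := by
    intro n
    rw [Finsupp.linearCombination_apply, Finsupp.toMultiset_apply, Finsupp.sum, Finsupp.sum,
      ← Multiset.coe_mapAddMonoidHom, map_sum, ← Multiset.coe_sumAddMonoidHom, map_sum]
    simp [Multiset.map_nsmul, Multiset.sum_nsmul]
  have hmem : ∀ s : Multiset (primeExponents D B),
      (s.map primeInvariant).prod ∈ killedBy D Set.univ := fun s =>
    Subalgebra.multiset_prod_mem _ fun f hf => by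
      obtain ⟨d, -, rfl⟩ := Multiset.mem_map.mp hf
      exact primeInvariant_mem d
  refine Multiset.toFinsupp.symm.injective (multiset_eq_of_prod_eq _ _ ?_)
  refine h.eq_of_restrict_eq (hmem _) (hmem _) ?_
  rw [restrictVars_multiset_prod, restrictVars_multiset_prod]
  exact congrArg (monomial · 1) ((key m).trans (hmn.trans (key n).symm))

theorem algebraicIndependent_primeInvariant (h : CascadeAction w D B) :
    AlgebraicIndependent ℂ (primeInvariant : primeExponents D B → _) := by
  refine AlgebraicIndependent.of_comp (restrictVars B) ?_
  convert algebraicIndependent_monomial h.linearIndependent_primeExponents using 2 with d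
  exact restrictVars_primeInvariant d

theorem linearIndependent_weight_primeExponents (h : CascadeAction w D B) :
    LinearIndependent ℝ fun d : primeExponents D B =>
      Finsupp.weight (fun β : B => w β) (d : B →₀ ℕ) := by
  classical
  have := Fintype.ofFinite B
  have h1 := linearIndependent_real_of_nat h.linearIndependent_primeExponents
  have h2 := h1.map' (Fintype.linearCombination ℝ fun β : B => w β)
    (LinearMap.ker_eq_bot.mpr h.weight_indep.fintypeLinearCombination_injective)
  suffices heq : (fun d : primeExponents D B => Finsupp.weight (fun β : B => w β) (d : B →₀ ℕ)) =
      (Fintype.linearCombination ℝ fun β : B => w β) ∘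
        fun (d : primeExponents D B) (s : B) => (((d : B →₀ ℕ) s : ℕ) : ℝ) by
    rwa [← heq] at h2
  funext d
  rw [Function.comp_apply]
  rw [Finsupp.weight_apply, Finsupp.sum_fintype _ _ (by simp)]
  simp [Fintype.linearCombination_apply, Nat.cast_smul_eq_nsmul]

theorem finite_primeExponents (h : CascadeAction w D B) : Finite (primeExponents D B) :=
  (linearIndependent_real_of_nat h.linearIndependent_primeExponents).finite

theorem card_primeExponents_le (h : CascadeAction w D B) :
    Nat.card (primeExponents D B) ≤ Nat.card B := by
  have := h.finite_primeExponents
  have := Fintype.ofFinite (primeExponents D B)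
  have := Fintype.ofFinite B
  have := (linearIndependent_real_of_nat h.linearIndependent_primeExponents).fintype_card_le_finrank
  simpa using this

theorem killedBy_univ_eq_adjoin (h : CascadeAction w D B) :
    killedBy D Set.univ =
      Algebra.adjoin ℂ (Set.range (primeInvariant : primeExponents D B → _)) := by
  classical
  refine le_antisymm (fun f hf => ?_) (Algebra.adjoin_le ?_)
  · rw [← sum_weightedHomogeneousComponent w f, finsum_def]
    split_ifs with hfin
    · refine Subalgebra.sum_mem _ fun ν _ => ?_
      have hmem := h.weightedHomogeneousComponent_mem ν hf
      obtain ⟨d, c, hd⟩ := h.restrict_eq_monomial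
        (weightedHomogeneousComponent_isWeightedHomogeneous (w := w) ν f)
      by_cases hc : c = 0
      · rw [hc, monomial_zero] at hd
        rw [h.eq_zero_of_restrict_eq_zero hmem hd]
        exact Subalgebra.zero_mem _
      · obtain ⟨s, a, -, hs⟩ := h.exists_eq_smul_prod hmem hc hd
        rw [hs]
        refine Subalgebra.smul_mem _ (Subalgebra.multiset_prod_mem _ fun g hg => ?_) _
        obtain ⟨d, -, rfl⟩ := Multiset.mem_map.mp hg
        exact Algebra.subset_adjoin ⟨d, rfl⟩
    · exact Subalgebra.zero_mem _
  · rintro _ ⟨d, rfl⟩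
    exact primeInvariant_mem d

end CascadeAction

section determinants

variable {A ι : Type*} [CommRing A] [DecidableEq ι]

theorem derivation_prod [Algebra ℂ A] (D : Derivation ℂ A A) (s : Finset ι) (f : ι → A) :
    D (∏ i ∈ s, f i) = ∑ i ∈ s, ∏ j ∈ s, if j = i then D (f j) else f j := by
  induction s using Finset.induction_on with
  | empty => simp
  | insert a s ha ih =>
    rw [Finset.prod_insert ha, D.leibniz, ih, Finset.sum_insert ha, Finset.prod_insert ha,
      if_pos rfl, smul_eq_mul, smul_eq_mul, Finset.mul_sum, add_comm, mul_comm]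
    congr 1
    · congr 1
      refine Finset.prod_congr rfl fun j hj => ?_
      rw [if_neg (ne_of_mem_of_not_mem hj ha)]
    · refine Finset.sum_congr rfl fun i hi => ?_
      rw [Finset.prod_insert ha, if_neg (ne_of_mem_of_not_mem hi ha).symm]

theorem derivation_det [Algebra ℂ A] [Fintype ι] (D : Derivation ℂ A A) (M : Matrix ι ι A) :
    D M.det = ∑ j, (M.updateCol j fun i => D (M i j)).det := by
  simp only [Matrix.det_apply', map_sum, D.leibniz, smul_eq_mul, derivation_prod]
  rw [Finset.sum_comm]
  refine Finset.sum_congr rfl fun σ _ => ?_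
  have hsign : D ((Equiv.Perm.sign σ : ℤ) : A) = 0 := D.map_intCast _
  rw [hsign, mul_zero, add_zero, Finset.mul_sum]
  refine Finset.sum_congr rfl fun j _ => ?_
  congr 1
  refine Finset.prod_congr rfl fun i _ => ?_
  rw [Matrix.updateCol_apply]
  split_ifs with hij
  · rw [hij]
  · rfl

theorem sum_det_updateRow_eq_sum_det_updateCol [Fintype ι] (M N : Matrix ι ι A) :
    ∑ i, (M.updateRow i (N i)).det = ∑ j, (M.updateCol j fun i => N i j).det := by
  have hcol : ∀ j, (M.updateCol j fun i => N i j).det = (M.adjugate * N) j j := fun j => by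
    rw [← Matrix.cramer_apply, Matrix.cramer_eq_adjugate_mulVec]
    rfl
  have hrow : ∀ i, (M.updateRow i (N i)).det = (N * M.adjugate) i i := fun i => by
    rw [← Matrix.cramer_transpose_apply, Matrix.cramer_eq_adjugate_mulVec,
      ← Matrix.adjugate_transpose, Matrix.mulVec_transpose]
    rfl
  simp only [hcol, hrow]
  exact Matrix.trace_mul_comm N M.adjugate

end determinants

namespace CascadeAction

open MvPolynomial

variable {P V : Type*} [Fintype P] [AddCommGroup V] [Module ℝ V] {w : P → V}
  {D : P → Derivation ℂ (MvPolynomial P ℂ) (MvPolynomial P ℂ)} {B : Set P}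

/-- The vector fields `D φ` span a space of rank at most `card (P \ B)`. -/
theorem card_le_of_det_ne_zero (h : CascadeAction w D B) {k : ℕ} (l : Fin k → P)
    (a : Fin k → MvPolynomial P ℂ) (hdet : (Matrix.of fun i j => D (l i) (a j)).det ≠ 0) :
    k ≤ Nat.card (Bᶜ : Set P) := by
  classical
  by_contra! hk
  let W : Submodule ℂ (MvPolynomial P ℂ) := Submodule.span ℂ
    (Set.range fun q : (Fin k → P) × (Fin k → MvPolynomial P ℂ) =>
      (Matrix.of fun i j => D (q.1 i) (q.2 j)).det)
  have hmem : ∀ (l : Fin k → P) (a : Fin k → MvPolynomial P ℂ),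
      (Matrix.of fun i j => D (l i) (a j)).det ∈ W := fun l a =>
    Submodule.subset_span ⟨(l, a), rfl⟩
  refine hdet (h.eq_zero_of_stable W ?_ ?_ _ (hmem l a))
  · intro v
    suffices W ≤ W.comap (D v).toLinearMap from fun f hf => this hf
    refine Submodule.span_le.mpr ?_
    rintro _ ⟨⟨l, a⟩, rfl⟩
    change D v (Matrix.of fun i j => D (l i) (a j)).det ∈ W
    choose c χ _ hcomm using fun i => h.commutator v (l i)
    set M : Matrix (Fin k) (Fin k) (MvPolynomial P ℂ) := Matrix.of fun i j => D (l i) (a j) with hM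
    have hsplit : ∀ i, (fun j => D v (M i j)) =
        (fun j => D (l i) (D v (a j))) + (C (c i) : MvPolynomial P ℂ) • fun j => D (χ i) (a j) := by
      intro i
      ext1 j
      simp [hM, hcomm, smul_eq_C_mul]
    rw [derivation_det, ← sum_det_updateRow_eq_sum_det_updateCol M fun i j => D v (M i j)]
    simp only [hsplit, Matrix.det_updateRow_add, Matrix.det_updateRow_smul, Finset.sum_add_distrib]
    rw [sum_det_updateRow_eq_sum_det_updateCol M fun i j => D (l i) (D v (a j))]
    refine W.add_mem (W.sum_mem fun j _ => ?_) (W.sum_mem fun i _ => ?_)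
    · convert hmem l (Function.update a j (D v (a j))) using 2
      ext1 i j'
      by_cases hj : j' = j <;> simp [hM, Function.update_apply, hj]
    · rw [← smul_eq_C_mul]
      refine W.smul_mem _ ?_
      convert hmem (Function.update l i (χ i)) a using 2
      ext1 i' j
      by_cases hi : i' = i <;> simp [hM, Matrix.updateRow_apply, Function.update_apply, hi]
  · suffices W ≤ LinearMap.ker (restrictVars B).toLinearMap from fun f hf => this hf
    refine Submodule.span_le.mpr ?_
    rintro _ ⟨⟨l, a⟩, rfl⟩
    change restrictVars B (Matrix.of fun i j => D (l i) (a j)).det = 0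
    by_cases hl : ∃ i, l i ∈ B
    · obtain ⟨i, hi⟩ := hl
      rw [AlgHom.map_det]
      exact Matrix.det_eq_zero_of_row_eq_zero i fun j => h.restrict_apply_of_mem hi _
    · push Not at hl
      have : ¬ Function.Injective fun i => (⟨l i, hl i⟩ : (Bᶜ : Set P)) := fun hinj => by
        have := Nat.card_le_card_of_injective _ hinj
        rw [Nat.card_fin] at this
        exact absurd this (not_le.mpr hk)
      rw [Function.not_injective_iff] at this
      obtain ⟨i, i', hii, hne⟩ := this
      rw [Matrix.det_zero_of_row_eq hne, map_zero]
      ext1 j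
      have hi : l i = l i' := congrArg Subtype.val hii
      simp only [Matrix.of_apply, hi]

end CascadeAction

/-- The elements of a domain which are fractions of elements of a subalgebra. -/
def fractions {A : Type*} [CommRing A] [IsDomain A] [Algebra ℂ A] (S : Subalgebra ℂ A) :
    Subalgebra ℂ A where
  carrier := {x | ∃ h ∈ S, h ≠ 0 ∧ h * x ∈ S}
  mul_mem' := by
    rintro x y ⟨g, hg, hg0, hgx⟩ ⟨h, hh, hh0, hhy⟩
    exact ⟨g * h, mul_mem hg hh, mul_ne_zero hg0 hh0, by
      rw [mul_mul_mul_comm]; exact mul_mem hgx hhy⟩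
  add_mem' := by
    rintro x y ⟨g, hg, hg0, hgx⟩ ⟨h, hh, hh0, hhy⟩
    refine ⟨g * h, mul_mem hg hh, mul_ne_zero hg0 hh0, ?_⟩
    have : g * h * (x + y) = h * (g * x) + g * (h * y) := by ring
    rw [this]
    exact add_mem (mul_mem hh hgx) (mul_mem hg hhy)
  algebraMap_mem' c := ⟨1, S.one_mem, one_ne_zero, by rw [one_mul]; exact S.algebraMap_mem c⟩

section fractions

variable {A : Type*} [CommRing A] [IsDomain A] [Algebra ℂ A] {S T : Subalgebra ℂ A}

theorem le_fractions : S ≤ fractions S := fun x hx => ⟨1, S.one_mem, one_ne_zero, by rwa [one_mul]⟩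

theorem fractions_mono (hST : S ≤ T) : fractions S ≤ fractions T := by
  rintro x ⟨h, hh, hh0, hx⟩
  exact ⟨h, hST hh, hh0, hST hx⟩

theorem mem_fractions_of_mul {x h : A} (hh : h ∈ fractions S) (hh0 : h ≠ 0)
    (hx : h * x ∈ fractions S) : x ∈ fractions S := by
  obtain ⟨g, hg, hg0, hgh⟩ := hh
  obtain ⟨k, hk, hk0, hkx⟩ := hx
  refine ⟨k * (g * h), mul_mem hk hgh, mul_ne_zero hk0 (mul_ne_zero hg0 hh0), ?_⟩
  have : k * (g * h) * x = g * (k * (h * x)) := by ring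
  rw [this]
  exact mul_mem hg hkx

theorem fractions_le_fractions (h : S ≤ fractions T) : fractions S ≤ fractions T := by
  rintro x ⟨g, hg, hg0, hx⟩
  exact mem_fractions_of_mul (h hg) hg0 (h hx)

theorem isAlgebraic_of_fractions_eq_top (h : fractions S = ⊤) : Algebra.IsAlgebraic S A := by
  refine ⟨fun x => ?_⟩
  obtain ⟨g, hg, hg0, hx⟩ : x ∈ fractions S := h ▸ Algebra.mem_top
  refine ⟨Polynomial.C ⟨g, hg⟩ * Polynomial.X - Polynomial.C ⟨g * x, hx⟩, fun h0 => ?_, ?_⟩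
  · have := congrArg (Polynomial.coeff · 1) h0
    simp only [Polynomial.coeff_sub, Polynomial.coeff_C_mul, Polynomial.coeff_X_one, mul_one,
      Polynomial.coeff_C_succ, sub_zero, Polynomial.coeff_zero] at this
    exact hg0 (congrArg Subtype.val this)
  · simp

end fractions

section slices

variable {A : Type*} [CommRing A] [Algebra ℂ A]

theorem derivation_iterate_mul_of_apply_eq_zero (D : Derivation ℂ A A) {u : A} (hu : D u = 0)
    (x : A) (k : ℕ) : D^[k] (u * x) = u * D^[k] x := by
  induction k with
  | zero => rfl
  | succ k ih =>
    rw [Function.iterate_succ_apply', ih, D.leibniz, hu, smul_zero, add_zero, smul_eq_mul,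
      Function.iterate_succ_apply']

variable [IsDomain A]

/-- If a derivation `D` is locally nilpotent on a stable subalgebra `R` and has a local slice `s`
in `R`, then the elements of `R` are fractions of polynomials in `s` over the kernel of `D`. -/
theorem mem_fractions_of_slice (D : Derivation ℂ A A) {R S : Subalgebra ℂ A} (hR : ∀ x ∈ R, D x ∈ R)
    (hS : ∀ x ∈ R, D x = 0 → x ∈ S) {s : A} (hs : s ∈ R) (hsS : s ∈ S) (hs0 : D s ≠ 0)
    (hs1 : D (D s) = 0) : ∀ (n : ℕ), ∀ x ∈ R, D^[n] x = 0 → x ∈ fractions S := by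
  have : CharZero A := charZero_of_injective_algebraMap (algebraMap ℂ A).injective
  have hiter : ∀ n, ∀ x ∈ R, D^[n] x ∈ R := by
    intro n
    induction n with
    | zero => exact fun x hx => hx
    | succ n ih =>
      intro x hx
      rw [Function.iterate_succ_apply']
      exact hR _ (ih x hx)
  intro n
  induction n with
  | zero =>
    intro x _ hx
    rw [Function.iterate_zero, id] at hx
    exact hx ▸ zero_mem _
  | succ n ih =>
    intro x hx hn
    have hfac : D (((n.factorial : ℕ) : A) * D s ^ n) = 0 := by
      rw [D.leibniz, D.leibniz_pow, hs1, D.map_natCast]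
      simp
    have htop : D (D^[n] x) = 0 := by
      rwa [← Function.iterate_succ_apply' (f := D)]
    have hfacS : ((n.factorial : ℕ) : A) * D s ^ n ∈ S :=
      hS _ (mul_mem (natCast_mem _ _) (pow_mem (hR s hs) n)) hfac
    refine mem_fractions_of_mul (le_fractions hfacS)
      (mul_ne_zero (Nat.cast_ne_zero.mpr n.factorial_ne_zero) (pow_ne_zero n hs0)) ?_
    have hdiff : ((n.factorial : ℕ) : A) * D s ^ n * x - D^[n] x * s ^ n ∈ fractions S := by
      refine ih _ (sub_mem (mul_mem (mul_mem (natCast_mem _ _) (pow_mem (hR s hs) n)) hx)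
        (mul_mem (hiter n x hx) (pow_mem hs n))) ?_
      rw [iterate_map_sub, derivation_iterate_mul_of_apply_eq_zero D hfac,
        derivation_iterate_mul_of_apply_eq_zero D htop, (derivation_iterate_pow D hs1 n).1]
      ring
    have := add_mem hdiff
      (le_fractions (mul_mem (hS _ (hiter n x hx) htop) (pow_mem hsS n)))
    rwa [sub_add_cancel] at this

end slices

namespace CascadeAction

open MvPolynomial

variable {P V : Type*} [Fintype P] [AddCommGroup V] [Module ℝ V] {w : P → V}
  {D : P → Derivation ℂ (MvPolynomial P ℂ) (MvPolynomial P ℂ)} {B : Set P}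

theorem exists_fractions_eq_top (h : CascadeAction w D B) {ℓ : V →ₗ[ℝ] ℝ} (hℓ : ∀ φ, 0 < ℓ (w φ))
    (T : Finset P) (hT : ∀ φ ∈ T, ∀ ψ, ℓ (w φ) < ℓ (w ψ) → ψ ∈ T) :
    ∃ (k : ℕ) (l : Fin k → P) (s : Fin k → MvPolynomial P ℂ), (∀ i, l i ∈ T) ∧
      (Matrix.of fun i j => D (l i) (s j)).det ≠ 0 ∧
      fractions (Algebra.adjoin ℂ (killedBy D (T : Set P) ∪ Set.range s)) = ⊤ := by
  classical
  induction T using Finset.induction_on_min_value (ℓ ∘ w) with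
  | empty =>
    refine ⟨0, Fin.elim0, Fin.elim0, fun i => i.elim0, by simp, ?_⟩
    refine eq_top_iff.mpr fun x _ => le_fractions (Algebra.subset_adjoin (Or.inl fun φ hφ => ?_))
    simp at hφ
  | insert a T haT hmin ih =>
    obtain ⟨k, l, s, hl, hdet, hfrac⟩ := ih fun φ hφ ψ hψ => by
      rcases Finset.mem_insert.mp (hT φ (Finset.mem_insert_of_mem hφ) ψ hψ) with rfl | hmem
      · exact absurd (hmin φ hφ) (not_le.mpr hψ)
      · exact hmem
    have hTup : ∀ φ ∈ T, ∀ χ, w χ = w a + w φ → χ ∈ T := by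
      intro φ hφ χ hχ
      have hlt : ℓ (w a) < ℓ (w χ) := by rw [hχ, map_add]; linarith [hℓ φ]
      rcases Finset.mem_insert.mp (hT a (Finset.mem_insert_self _ _) χ hlt) with rfl | hmem
      · exact absurd hlt (lt_irrefl _)
      · exact hmem
    have hstable : ∀ x ∈ killedBy D (T : Set P), D a x ∈ killedBy D (T : Set P) := by
      intro x hx φ hφ
      obtain ⟨c, χ, hc, hcomm⟩ := h.commutator φ a
      rw [hcomm, hx φ hφ, map_zero, zero_add]
      rcases hc with rfl | hχ
      · rw [zero_smul]
      · rw [hx χ (hTup φ hφ χ (by rw [hχ, add_comm])), smul_zero]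
    have hinsert : ∀ x ∈ killedBy D (T : Set P), D a x = 0 →
        x ∈ killedBy D ((insert a T : Finset P) : Set P) := by
      intro x hx hax φ hφ
      rcases Finset.mem_insert.mp (Finset.mem_coe.mp hφ) with rfl | hφ
      · exact hax
      · exact hx φ hφ
    by_cases ha : ∃ f ∈ killedBy D (T : Set P), D a f ≠ 0
    · obtain ⟨f, hf, hf0⟩ := ha
      obtain ⟨n, hn, hn'⟩ := exists_last_iterate (h.exists_iterate_eq_zero a (D a f)) hf0
      have hiter : ∀ n, (D a)^[n] f ∈ killedBy D (T : Set P) := by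
        intro n
        induction n with
        | zero => exact hf
        | succ n ih =>
          rw [Function.iterate_succ_apply']
          exact hstable _ ih
      set σ := (D a)^[n] f with hσ
      have hσ0 : D a σ ≠ 0 := by
        rwa [hσ, ← Function.iterate_succ_apply' (f := D a), Function.iterate_succ_apply]
      have hσ1 : D a (D a σ) = 0 := by
        rwa [hσ, ← Function.iterate_succ_apply' (f := D a),
          ← Function.iterate_succ_apply' (f := D a), Function.iterate_succ_apply]
      refine ⟨k + 1, Fin.cons a l, Fin.cons σ s, ?_, ?_, ?_⟩
      · exact Fin.cases (Finset.mem_insert_self _ _) fun i => Finset.mem_insert_of_mem (hl i)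
      · rw [Matrix.det_succ_column_zero, Finset.sum_eq_single 0]
        · refine mul_ne_zero (mul_ne_zero (by simp) (by simpa using hσ0)) ?_
          convert hdet using 2
          ext1 i j
          simp
        · intro i _ hi
          obtain ⟨i, rfl⟩ := Fin.exists_succ_eq.mpr hi
          have : D (l i) σ = 0 := hiter n (l i) (hl i)
          simp [this]
        · simp
      · set S := Algebra.adjoin ℂ
          ((killedBy D ((insert a T : Finset P) : Set P) : Set (MvPolynomial P ℂ)) ∪
            Set.range (Fin.cons σ s : Fin (k + 1) → MvPolynomial P ℂ)) with hS
        have hsS : ∀ i, (Fin.cons σ s : Fin (k + 1) → MvPolynomial P ℂ) i ∈ S := fun i =>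
          Algebra.subset_adjoin (Or.inr ⟨i, rfl⟩)
        rw [eq_top_iff, ← hfrac]
        refine fractions_le_fractions (Algebra.adjoin_le (Set.union_subset ?_ ?_))
        · intro x hx
          obtain ⟨n', hn'⟩ := h.exists_iterate_eq_zero a x
          exact mem_fractions_of_slice (D a) hstable
            (fun y hy hy0 => Algebra.subset_adjoin (Or.inl (hinsert y hy hy0))) (hiter n) (hsS 0)
            hσ0 hσ1 n' x hx hn'
        · rintro _ ⟨i, rfl⟩
          exact le_fractions (hsS i.succ)
    · push Not at ha
      refine ⟨k, l, s, fun i => Finset.mem_insert_of_mem (hl i), hdet, ?_⟩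
      rw [eq_top_iff, ← hfrac]
      exact fractions_mono (Algebra.adjoin_mono (Set.union_subset_union_left _
        fun x hx => hinsert x hx (ha x hx)))

theorem card_le_card_primeExponents (h : CascadeAction w D B) :
    Nat.card B ≤ Nat.card (primeExponents D B) := by
  classical
  obtain ⟨ℓ, hℓ⟩ := h.height
  obtain ⟨k, l, s, -, hdet, hfrac⟩ := h.exists_fractions_eq_top hℓ Finset.univ (by simp)
  have hk := h.card_le_of_det_ne_zero l s hdet
  have := h.finite_primeExponents
  rw [Finset.coe_univ, h.killedBy_univ_eq_adjoin] at hfrac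
  have hadj : Algebra.adjoin ℂ
      ((Algebra.adjoin ℂ (Set.range (primeInvariant : primeExponents D B → _)) :
        Set (MvPolynomial P ℂ)) ∪ Set.range s) =
      Algebra.adjoin ℂ (Set.range (primeInvariant : primeExponents D B → _) ∪ Set.range s) := by
    rw [Algebra.adjoin_union, Algebra.adjoin_union, Algebra.adjoin_eq]
  rw [hadj] at hfrac
  have := isAlgebraic_of_fractions_eq_top hfrac
  have htr := Algebra.IsAlgebraic.trdeg_le_cardinalMk (R := ℂ) (A := MvPolynomial P ℂ)
    (Set.range (primeInvariant : primeExponents D B → _) ∪ Set.range s)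
  rw [MvPolynomial.trdeg_of_isDomain] at htr
  have hfin : (Set.range (primeInvariant : primeExponents D B → MvPolynomial P ℂ) ∪
    Set.range s).Finite := (Set.finite_range _).union (Set.finite_range _)
  have hP : Nat.card P ≤ (Set.range (primeInvariant : primeExponents D B → MvPolynomial P ℂ) ∪
      Set.range s).ncard := by
    have := Cardinal.toNat_le_toNat htr (Cardinal.lt_aleph0_iff_set_finite.mpr hfin)
    rwa [Cardinal.toNat_lift] at this
  have hunion := Set.ncard_union_le
    (Set.range (primeInvariant : primeExponents D B → MvPolynomial P ℂ)) (Set.range s)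
  have h1 := Finite.card_range_le (primeInvariant : primeExponents D B → MvPolynomial P ℂ)
  have h2 := Finite.card_range_le s
  rw [Nat.card_fin] at h2
  have h3 : Nat.card B + Nat.card (Bᶜ : Set P) = Nat.card P := by
    rw [Nat.card_coe_set_eq, Nat.card_coe_set_eq, Set.ncard_add_ncard_compl]
  rw [Nat.card_coe_set_eq] at h1 h2
  omega

theorem card_primeExponents (h : CascadeAction w D B) :
    Nat.card (primeExponents D B) = Nat.card B :=
  le_antisymm h.card_primeExponents_le h.card_le_card_primeExponents

end CascadeAction

namespace RootSystemData

variable {V : Type*} [NormedAddCommGroup V] [InnerProductSpace ℝ V] (R : RootSystemData V)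

theorem ne_zero_of_mem {α : V} (h : α ∈ R.Δ) : α ≠ 0 := fun h0 => R.zero_not_mem (h0 ▸ h)

theorem inner_self_pos {α : V} (h : α ∈ R.Δ) : 0 < ⟪α, α⟫_ℝ :=
  real_inner_self_pos.mpr (R.ne_zero_of_mem h)

theorem mem_of_pos {α : V} (h : α ∈ R.Pos) : α ∈ R.Δ := R.pos_subset h

theorem finite_pos : R.Pos.Finite := R.finite.subset R.pos_subset

theorem sub_mem_of_inner_pos {α β : V} (hα : α ∈ R.Δ) (hβ : β ∈ R.Δ) (h : 0 < ⟪α, β⟫_ℝ)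
    (hne : α ≠ β) : α - β ∈ R.Δ := by
  have hαα := R.inner_self_pos hα
  have hββ := R.inner_self_pos hβ
  obtain ⟨n, hn⟩ := R.crystal α hα β hβ
  obtain ⟨m, hm⟩ := R.crystal β hβ α hα
  have hcomm := real_inner_comm α β
  have hn0 : (0 : ℝ) < n := by
    by_contra hle
    nlinarith
  have hm0 : (0 : ℝ) < m := by
    by_contra hle
    nlinarith
  by_cases hn1 : n = 1
  · have hmem := R.reflect_mem α hα β hβ
    rwa [hn, mul_div_cancel_right₀ _ hββ.ne', hn1, Int.cast_one, one_smul] at hmem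
  by_cases hm1 : m = 1
  · have hmem := R.neg_mem _ (R.reflect_mem β hβ α hα)
    rwa [hm, mul_div_cancel_right₀ _ hαα.ne', hm1, Int.cast_one, one_smul, neg_sub] at hmem
  have hn2 : (2 : ℝ) ≤ n := by
    have : 0 < n := by exact_mod_cast hn0
    exact_mod_cast (by omega : 2 ≤ n)
  have hm2 : (2 : ℝ) ≤ m := by
    have : 0 < m := by exact_mod_cast hm0
    exact_mod_cast (by omega : 2 ≤ m)
  refine absurd (real_inner_self_nonpos.mp ?_) (sub_ne_zero.mpr hne)
  rw [inner_sub_left, inner_sub_right, inner_sub_right]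
  nlinarith

theorem add_mem_of_inner_neg {α β : V} (hα : α ∈ R.Δ) (hβ : β ∈ R.Δ) (h : ⟪α, β⟫_ℝ < 0)
    (hne : α ≠ -β) : α + β ∈ R.Δ := by
  have := R.sub_mem_of_inner_pos hα (R.neg_mem β hβ) (by rw [inner_neg_right]; linarith) hne
  rwa [sub_neg_eq_add] at this

theorem ne_neg_of_pos {α β : V} (hα : α ∈ R.Pos) (hβ : β ∈ R.Pos) : α ≠ -β := fun h =>
  R.not_neg_mem β hβ (h ▸ hα)

theorem multiset_sum_ne_zero (s : Multiset V) (hs : ∀ α ∈ s, α ∈ R.Pos) (h0 : s ≠ 0) :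
    s.sum ≠ 0 := by
  classical
  induction hn : s.card using Nat.strong_induction_on generalizing s with
  | _ n ih =>
    intro hsum
    obtain ⟨α, hαs⟩ := Multiset.exists_mem_of_ne_zero h0
    obtain ⟨t, rfl⟩ := Multiset.exists_cons_of_mem hαs
    have hα := hs α (Multiset.mem_cons_self _ _)
    have ht : ∀ β ∈ t, β ∈ R.Pos := fun β hβ => hs β (Multiset.mem_cons_of_mem hβ)
    rw [Multiset.sum_cons] at hsum
    obtain ⟨β, hβ, hneg⟩ : ∃ β ∈ t, ⟪α, β⟫_ℝ < 0 := by
      by_contra! hcon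
      have h1 : ⟪α, t.sum⟫_ℝ = (t.map fun β => ⟪α, β⟫_ℝ).sum :=
        map_multiset_sum (innerₗ V α) t
      have h2 : 0 ≤ (t.map fun β => ⟪α, β⟫_ℝ).sum :=
        Multiset.sum_nonneg fun x hx => by
          obtain ⟨β, hβ, rfl⟩ := Multiset.mem_map.mp hx
          exact hcon β hβ
      rw [← h1, eq_neg_of_add_eq_zero_right hsum, inner_neg_right] at h2
      linarith [R.inner_self_pos (R.mem_of_pos hα)]
    have hadd := R.pos_add α hα β (ht β hβ) (R.add_mem_of_inner_neg (R.mem_of_pos hα)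
      (R.mem_of_pos (ht β hβ)) hneg (R.ne_neg_of_pos hα (ht β hβ)))
    obtain ⟨u, rfl⟩ := Multiset.exists_cons_of_mem hβ
    refine ih _ ?_ ((α + β) ::ₘ u) ?_ (Multiset.cons_ne_zero) rfl ?_
    · rw [← hn]; simp
    · intro γ hγ
      rcases Multiset.mem_cons.mp hγ with rfl | hγ
      · exact hadd
      · exact ht γ (Multiset.mem_cons_of_mem hγ)
    · rw [Multiset.sum_cons] at hsum ⊢
      rw [add_assoc, hsum]

/-- The additive monoid generated by the positive roots. -/
def cone : AddSubmonoid V := AddSubmonoid.closure R.Pos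

theorem mem_cone_of_pos {α : V} (h : α ∈ R.Pos) : α ∈ R.cone := AddSubmonoid.subset_closure h

theorem add_ne_zero_of_mem_cone {x α : V} (hx : x ∈ R.cone) (hα : α ∈ R.Pos) : x + α ≠ 0 := by
  obtain ⟨s, hs, rfl⟩ := AddSubmonoid.exists_multiset_of_mem_closure hx
  have := R.multiset_sum_ne_zero (α ::ₘ s)
    (fun β hβ => (Multiset.mem_cons.mp hβ).elim (fun h => h ▸ hα) (hs β)) Multiset.cons_ne_zero
  rwa [Multiset.sum_cons, add_comm] at this

theorem neg_notMem_cone {α : V} (hα : α ∈ R.Pos) : -α ∉ R.cone := fun h =>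
  R.add_ne_zero_of_mem_cone h hα (neg_add_cancel α)

theorem eq_zero_of_mem_cone {x : V} (hx : x ∈ R.cone) (hx' : -x ∈ R.cone) : x = 0 := by
  obtain ⟨s, hs, hsum⟩ := AddSubmonoid.exists_multiset_of_mem_closure hx
  rcases s.empty_or_exists_mem with rfl | ⟨α, hα⟩
  · simpa using hsum.symm
  · obtain ⟨t, rfl⟩ := Multiset.exists_cons_of_mem hα
    have ht : t.sum ∈ R.cone := AddSubmonoid.multiset_sum_mem _ _ fun β hβ =>
      R.mem_cone_of_pos (hs β (Multiset.mem_cons_of_mem hβ))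
    refine absurd ?_ (R.add_ne_zero_of_mem_cone (add_mem ht hx') (hs α hα))
    rw [← hsum, Multiset.sum_cons]
    abel

theorem nonnegComb_iff {x : V} : R.NonnegComb x ↔ x ∈ R.cone := by
  classical
  constructor
  · rintro ⟨c, hc, rfl⟩
    refine sum_mem fun α hα => ?_
    dsimp only
    rw [Nat.cast_smul_eq_nsmul]
    exact nsmul_mem (R.mem_cone_of_pos (hc hα)) _
  · intro hx
    induction hx using AddSubmonoid.closure_induction with
    | mem α hα =>
      refine ⟨Finsupp.single α 1, fun β hβ => ?_, by simp⟩
      rw [Finset.mem_coe, Finsupp.mem_support_single] at hβ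
      exact hβ.1 ▸ hα
    | zero => exact ⟨0, by simp, by simp⟩
    | add x y _ _ hx hy =>
      obtain ⟨c, hc, rfl⟩ := hx
      obtain ⟨d, hd, rfl⟩ := hy
      refine ⟨c + d, fun α hα => ?_, ?_⟩
      · rcases Finset.mem_union.mp (Finsupp.support_add hα) with h | h
        · exact hc h
        · exact hd h
      · rw [Finsupp.sum_add_index'] <;> intros <;> simp [add_smul]

theorem pos_induction {p : V → Prop} (simple : ∀ α ∈ R.Simple, p α)
    (add : ∀ β ∈ R.Pos, ∀ γ ∈ R.Pos, β + γ ∈ R.Pos → p β → p γ → p (β + γ)) :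
    ∀ φ ∈ R.Pos, p φ := by
  intro φ hφ
  have key : ∀ β ∈ R.Pos, ∀ γ ∈ R.Pos,
      {ψ ∈ R.Pos | β - ψ ∈ R.cone ∧ ψ ≠ β}.ncard <
        {ψ ∈ R.Pos | β + γ - ψ ∈ R.cone ∧ ψ ≠ β + γ}.ncard := by
    intro β hβ γ hγ
    refine Set.ncard_lt_ncard ?_ (R.finite_pos.subset fun ψ h => h.1)
    refine (Set.ssubset_iff_of_subset ?_).mpr ⟨β, ⟨hβ, ?_, ?_⟩, fun h => h.2.2 rfl⟩
    · rintro ψ ⟨hψ, hψc, -⟩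
      refine ⟨hψ, ?_, ?_⟩
      · rw [add_sub_right_comm]
        exact add_mem hψc (R.mem_cone_of_pos hγ)
      · rintro rfl
        rw [sub_add_cancel_left] at hψc
        exact R.neg_notMem_cone hγ hψc
    · rw [add_sub_cancel_left]
      exact R.mem_cone_of_pos hγ
    · exact fun h => R.ne_zero_of_mem (R.mem_of_pos hγ) (left_eq_add.mp h)
  induction hn : {ψ ∈ R.Pos | φ - ψ ∈ R.cone ∧ ψ ≠ φ}.ncard using Nat.strong_induction_on
    generalizing φ with
  | _ n ih =>
    by_cases hs : φ ∈ R.Simple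
    · exact simple φ hs
    · obtain ⟨β, hβ, γ, hγ, rfl⟩ : ∃ β ∈ R.Pos, ∃ γ ∈ R.Pos, φ = β + γ := by
        by_contra h
        exact hs ⟨hφ, h⟩
      refine add β hβ γ hγ hφ (ih _ (hn ▸ key β hβ γ hγ) β hβ rfl) (ih _ ?_ γ hγ rfl)
      have := key γ hγ β hβ
      rwa [add_comm γ β, hn] at this

theorem pos_mem_closure_simple {φ : V} (hφ : φ ∈ R.Pos) : φ ∈ AddSubmonoid.closure R.Simple :=
  R.pos_induction (p := (· ∈ AddSubmonoid.closure R.Simple))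
    (fun _ h => AddSubmonoid.subset_closure h) (fun _ _ _ _ _ h h' => add_mem h h') φ hφ

theorem inner_simple_nonpos {α β : V} (hα : α ∈ R.Simple) (hβ : β ∈ R.Simple) (hne : α ≠ β) :
    ⟪α, β⟫_ℝ ≤ 0 := by
  by_contra! h
  have hmem := R.sub_mem_of_inner_pos (R.mem_of_pos hα.1) (R.mem_of_pos hβ.1) h hne
  rcases R.mem_or_neg _ hmem with h | h
  · exact hα.2 ⟨_, h, β, hβ.1, by abel⟩
  · exact hβ.2 ⟨_, h, α, hα.1, by abel⟩

theorem eq_of_add_eq_smul_simple {α : V} (hα : α ∈ R.Simple) (n : ℕ) :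
    ∀ β ∈ R.Pos, ∀ γ ∈ R.Pos, β + γ = (n : ℝ) • α → β = α ∧ γ = α := by
  have hαΔ := R.mem_of_pos hα.1
  have hα0 := R.ne_zero_of_mem hαΔ
  have hmul : ∀ t : ℝ, t • α ∈ R.Pos → t = 1 := fun t ht =>
    (R.reduced α hαΔ t (R.mem_of_pos ht)).resolve_right fun h => by
      rw [h, neg_one_smul] at ht
      exact R.not_neg_mem α hα.1 ht
  induction n with
  | zero =>
    intro β hβ γ hγ h
    rw [Nat.cast_zero, zero_smul] at h
    exact absurd h (R.add_ne_zero_of_mem_cone (R.mem_cone_of_pos hβ) hγ)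
  | succ n ih =>
    have step : ∀ β ∈ R.Pos, ∀ γ ∈ R.Pos, β + γ = ((n + 1 : ℕ) : ℝ) • α → 0 < ⟪β, α⟫_ℝ →
        β = α ∧ γ = α := by
      intro β hβ γ hγ h hpos
      rw [Nat.cast_succ, add_smul, one_smul] at h
      by_cases hβα : β = α
      · refine ⟨hβα, ?_⟩
        subst hβα
        have hγ' : γ = (n : ℝ) • β := by rw [add_comm] at h; exact add_right_cancel h
        have := hmul n (hγ' ▸ hγ)
        rw [hγ', this, one_smul]
      · have hmem := R.sub_mem_of_inner_pos (R.mem_of_pos hβ) hαΔ hpos hβα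
        rcases R.mem_or_neg _ hmem with h' | h'
        · have heq := (ih _ h' γ hγ (by rw [sub_add_eq_add_sub, h, add_sub_cancel_right])).1
          have h2 : β = (2 : ℝ) • α := by rw [two_smul, ← sub_eq_iff_eq_add.mp heq]
          have := hmul 2 (h2 ▸ hβ)
          norm_num at this
        · exact absurd ⟨_, h', β, hβ, by abel⟩ hα.2
    intro β hβ γ hγ h
    by_cases hpos : 0 < ⟪β, α⟫_ℝ
    · exact step β hβ γ hγ h hpos
    · refine (step γ hγ β hβ (by rw [add_comm, h]) ?_).symm
      have h1 : ⟪β, α⟫_ℝ + ⟪γ, α⟫_ℝ = ((n + 1 : ℕ) : ℝ) * ⟪α, α⟫_ℝ := by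
        rw [← inner_add_left, h, real_inner_smul_left]
      have h2 : 0 < ((n + 1 : ℕ) : ℝ) * ⟪α, α⟫_ℝ :=
        mul_pos (by exact_mod_cast n.succ_pos) (R.inner_self_pos hαΔ)
      linarith

theorem reflectRoot_reflectRoot {α : V} (hα : α ≠ 0) (v : V) :
    reflectRoot α (reflectRoot α v) = v := by
  have hαα : ⟪α, α⟫_ℝ ≠ 0 := inner_self_ne_zero.mpr hα
  unfold reflectRoot
  rw [inner_sub_left, real_inner_smul_left, sub_sub, ← add_smul]
  have : 2 * ⟪v, α⟫_ℝ / ⟪α, α⟫_ℝ +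
      2 * (⟪v, α⟫_ℝ - 2 * ⟪v, α⟫_ℝ / ⟪α, α⟫_ℝ * ⟪α, α⟫_ℝ) / ⟪α, α⟫_ℝ = 0 := by
    field_simp
    ring
  rw [this, zero_smul, sub_zero]

theorem inner_reflectRoot {α : V} (hα : α ≠ 0) (v : V) :
    ⟪reflectRoot α v, α⟫_ℝ = -⟪v, α⟫_ℝ := by
  have hαα : ⟪α, α⟫_ℝ ≠ 0 := inner_self_ne_zero.mpr hα
  unfold reflectRoot
  rw [inner_sub_left, real_inner_smul_left]
  field_simp
  ring

theorem reflectRoot_simple_mem {α β : V} (hα : α ∈ R.Simple) (hβ : β ∈ R.Pos) (hne : β ≠ α) :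
    reflectRoot α β ∈ R.Pos ∧ reflectRoot α β ≠ α := by
  have hαΔ := R.mem_of_pos hα.1
  have hα0 := R.ne_zero_of_mem hαΔ
  constructor
  · have hmem : reflectRoot α β ∈ R.Δ := R.reflect_mem β (R.mem_of_pos hβ) α hαΔ
    rcases R.mem_or_neg _ hmem with h | h
    · exact h
    exfalso
    obtain ⟨n, hn⟩ := R.crystal β (R.mem_of_pos hβ) α hαΔ
    have hrefl : reflectRoot α β = β - (n : ℝ) • α := by
      unfold reflectRoot
      rw [hn, mul_div_cancel_right₀ _ (inner_self_ne_zero.mpr hα0)]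
    rw [hrefl, neg_sub] at h
    rcases le_or_gt 0 n with hn0 | hn0
    · lift n to ℕ using hn0
      exact hne (R.eq_of_add_eq_smul_simple hα n β hβ _ h (by simp)).1
    · obtain ⟨k, hk⟩ := Int.eq_ofNat_of_zero_le (neg_nonneg.mpr hn0.le)
      obtain rfl : n = -(k : ℤ) := by omega
      refine R.add_ne_zero_of_mem_cone (α := β)
        (add_mem (nsmul_mem (R.mem_cone_of_pos hα.1) k) (R.mem_cone_of_pos h)) hβ ?_
      rw [← Nat.cast_smul_eq_nsmul ℝ]
      push_cast
      module
  · intro h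
    have h1 := reflectRoot_reflectRoot hα0 β
    have h2 : reflectRoot α α = -α := by
      unfold reflectRoot
      rw [mul_div_cancel_right₀ _ (inner_self_ne_zero.mpr hα0)]
      module
    rw [h, h2] at h1
    exact R.not_neg_mem α hα.1 (h1 ▸ hβ)

theorem exists_height : ∃ ℓ : V →ₗ[ℝ] ℝ, ∀ φ ∈ R.Pos, 0 < ℓ φ := by
  classical
  set s := R.finite_pos.toFinset with hs
  have hmem : ∀ {φ}, φ ∈ s ↔ φ ∈ R.Pos := by simp [hs]
  have hsimple : ∀ α ∈ R.Simple, 0 < ⟪∑ φ ∈ s, φ, α⟫_ℝ := by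
    intro α hα
    have hα0 := R.ne_zero_of_mem (R.mem_of_pos hα.1)
    rw [← Finset.add_sum_erase s _ (hmem.mpr hα.1), inner_add_left, sum_inner]
    have h1 : ∑ φ ∈ s.erase α, ⟪φ, α⟫_ℝ = ∑ φ ∈ s.erase α, -⟪φ, α⟫_ℝ := by
      refine Finset.sum_nbij' (reflectRoot α) (reflectRoot α) ?_ ?_
        (fun φ _ => reflectRoot_reflectRoot hα0 φ) (fun φ _ => reflectRoot_reflectRoot hα0 φ)
        (fun φ _ => by rw [inner_reflectRoot hα0, neg_neg])
      all_goals
        intro φ hφ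
        rw [Finset.mem_erase, hmem] at hφ ⊢
        exact (R.reflectRoot_simple_mem hα hφ.2 hφ.1).symm
    rw [Finset.sum_neg_distrib] at h1
    linarith [R.inner_self_pos (R.mem_of_pos hα.1)]
  refine ⟨innerₗ V (∑ φ ∈ s, φ), R.pos_induction (fun α hα => ?_) fun β _ γ _ _ hβ hγ => ?_⟩
  · exact hsimple α hα
  · rw [map_add]
    exact add_pos hβ hγ

theorem linearIndependent_simple : LinearIndependent ℝ fun α : R.Simple => (α : V) := by
  obtain ⟨ℓ, hℓ⟩ := R.exists_height
  refine LinearMap.BilinForm.linearIndependent_of_pairwise_le_zero (innerₗ V) ?_ ℓ _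
    (fun α => hℓ α α.2.1) fun α β hne => ?_
  · intro x hx
    exact real_inner_self_pos.mpr hx
  · exact R.inner_simple_nonpos α.2 β.2 (Subtype.coe_injective.ne hne)

theorem span_simple : ⊤ ≤ Submodule.span ℝ (Set.range fun α : R.Simple => (α : V)) := by
  rw [Subtype.range_coe, ← R.span_top, Submodule.span_le]
  have hpos : ∀ φ ∈ R.Pos, φ ∈ Submodule.span ℝ R.Simple := fun φ hφ =>
    AddSubmonoid.closure_le (S := (Submodule.span ℝ R.Simple).toAddSubmonoid)|>.mpr
      Submodule.subset_span (R.pos_mem_closure_simple hφ)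
  intro φ hφ
  rcases R.mem_or_neg φ hφ with h | h
  · exact hpos φ h
  · exact neg_neg φ ▸ Submodule.neg_mem _ (hpos _ h)

/-- The basis of simple roots. -/
noncomputable def simpleBasis : Module.Basis R.Simple ℝ V :=
  .mk R.linearIndependent_simple R.span_simple

@[simp]
theorem simpleBasis_apply (α : R.Simple) : R.simpleBasis α = α :=
  Module.Basis.mk_apply _ _ _

theorem coord_self (α : R.Simple) : R.simpleBasis.coord α α = 1 := by
  rw [← R.simpleBasis_apply α, Module.Basis.coord_apply, Module.Basis.repr_self,
    Finsupp.single_eq_same]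

theorem coord_nonneg_of_mem_cone (α : R.Simple) {x : V} (hx : x ∈ R.cone) :
    0 ≤ R.simpleBasis.coord α x := by
  classical
  have hpos : ∀ φ ∈ R.Pos, 0 ≤ R.simpleBasis.coord α φ := by
    refine R.pos_induction (fun β hβ => ?_) fun β _ γ _ _ hβ hγ => ?_
    · have h : β = R.simpleBasis ⟨β, hβ⟩ := (R.simpleBasis_apply ⟨β, hβ⟩).symm
      rw [h, Module.Basis.coord_apply, Module.Basis.repr_self, Finsupp.single_apply]
      split_ifs <;> simp
    · rw [map_add]
      exact add_nonneg hβ hγ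
  induction hx using AddSubmonoid.closure_induction with
  | mem φ hφ => exact hpos φ hφ
  | zero => simp
  | add x y _ _ hx hy =>
    rw [map_add]
    exact add_nonneg hx hy

theorem coord_nonneg (α : R.Simple) {φ : V} (hφ : φ ∈ R.Pos) : 0 ≤ R.simpleBasis.coord α φ :=
  R.coord_nonneg_of_mem_cone α (R.mem_cone_of_pos hφ)

theorem mem_span_iff {J : Set V} (hJ : J ⊆ R.Simple) {x : V} :
    x ∈ Submodule.span ℝ J ↔ ∀ α : R.Simple, (α : V) ∉ J → R.simpleBasis.coord α x = 0 := by
  have himg : J = R.simpleBasis '' {α | (α : V) ∈ J} := by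
    ext v
    constructor
    · exact fun hv => ⟨⟨v, hJ hv⟩, hv, R.simpleBasis_apply _⟩
    · rintro ⟨α, hα, rfl⟩
      rwa [simpleBasis_apply]
  rw [himg, Module.Basis.mem_span_image, ← himg]
  constructor
  · intro h α hα
    by_contra h0
    exact hα (h (Finsupp.mem_support_iff.mpr h0))
  · intro h α hα
    by_contra h0
    exact Finsupp.mem_support_iff.mp hα (h α h0)

theorem mem_support_iff {φ : V} (α : R.Simple) :
    (α : V) ∈ R.support φ ↔ R.simpleBasis.coord α φ ≠ 0 := by
  unfold support
  rw [Set.mem_ofPred_eq, R.mem_span_iff Set.sdiff_subset]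
  constructor
  · rintro ⟨-, h⟩ h0
    refine h fun β hβ => ?_
    have hβα : (β : V) = α := by
      by_contra hne
      exact hβ ⟨β.2, hne⟩
    rwa [Subtype.coe_injective hβα]
  · exact fun h => ⟨α.2, fun h' => h (h' α fun hα => hα.2 rfl)⟩

theorem inner_eq_sum_coord_mul_inner (x y : V) :
    ⟪x, y⟫_ℝ = (R.simpleBasis.repr x).sum fun α t => t * ⟪(α : V), y⟫_ℝ := by
  conv_lhs => rw [← R.simpleBasis.linearCombination_repr x, Finsupp.linearCombination_apply]
  rw [Finsupp.sum_inner]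
  simp [real_inner_smul_left]

end RootSystemData

section components

variable {V : Type*} [NormedAddCommGroup V] [InnerProductSpace ℝ V] {S C D : Set V}

theorem IsIrred.subset_left {A B : Set V} (h : IsIrred (A ∪ B)) (hA : A.Nonempty)
    (hAB : A ∩ B = ∅) (horth : ∀ a ∈ A, ∀ b ∈ B, ⟪a, b⟫_ℝ = 0) : A ∪ B ⊆ A := by
  rintro x (hx | hx)
  · exact hx
  · exact absurd ⟨A, B, rfl, hAB, hA, ⟨x, hx⟩, horth⟩ h.2

theorem IsComponent.subset_of_isIrred (h : IsComponent S C) (hD : IsIrred D) (hDS : D ⊆ S)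
    (hne : (D ∩ C).Nonempty) : D ⊆ C := by
  have hunion : D ∩ C ∪ D \ C = D := Set.inter_union_sdiff D C
  have := IsIrred.subset_left (A := D ∩ C) (B := D \ C) (hunion.symm ▸ hD) hne (by
    ext x
    simp only [Set.mem_inter_iff, Set.mem_sdiff, Set.mem_empty_iff_false, iff_false]
    tauto) fun a ha b hb => h.2.2 a ha.2 b ⟨hDS hb.1, hb.2⟩
  rw [hunion] at this
  exact fun x hx => (this hx).2

theorem IsComponent.eq_or_orthogonal {C' : Set V} (h : IsComponent S C) (h' : IsComponent S C') :
    C = C' ∨ ∀ a ∈ C, ∀ b ∈ C', ⟪a, b⟫_ℝ = 0 := by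
  by_cases hne : (C ∩ C').Nonempty
  · refine Or.inl (Set.Subset.antisymm (h'.subset_of_isIrred h.2.1 h.1 hne)
      (h.subset_of_isIrred h'.2.1 h'.1 ?_))
    rwa [Set.inter_comm]
  · refine Or.inr fun a ha b hb => h.2.2 a ha b ⟨h'.1 hb, fun hbC => hne ⟨b, hbC, hb⟩⟩

theorem exists_isComponent (hS : S.Finite) {ψ : V} (hψ : ψ ∈ S) : ∃ C, IsComponent S C ∧ ψ ∈ C := by
  let F : Set (Set V) := {T | T ⊆ S ∧ ψ ∈ T ∧ ∀ a ∈ T, ∀ b ∈ S \ T, ⟪a, b⟫_ℝ = 0}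
  have hFfin : F.Finite := hS.finite_subsets.subset fun T hT => hT.1
  have hSF : S ∈ F := ⟨subset_rfl, hψ, fun a _ b hb => absurd hb.1 hb.2⟩
  obtain ⟨T, hT⟩ := hFfin.exists_minimal ⟨S, hSF⟩
  obtain ⟨hTS, hψT, horth⟩ := hT.prop
  refine ⟨T, ⟨hTS, ⟨⟨ψ, hψT⟩, ?_⟩, horth⟩, hψT⟩
  have key : ∀ A B : Set V, A ∪ B = T → A ∩ B = ∅ → B.Nonempty →
      (∀ a ∈ A, ∀ b ∈ B, ⟪a, b⟫_ℝ = 0) → ψ ∉ A := by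
    intro A B hAB hinter ⟨b, hb⟩ hAorth hψA
    have hAT : A ⊆ T := hAB ▸ Set.subset_union_left
    have hle : T ⊆ A := hT.le_of_le (y := A) ⟨hAT.trans hTS, hψA, fun a ha b hb => ?_⟩ hAT
    · exact Set.notMem_empty b (hinter ▸ ⟨hle (hAB ▸ Or.inr hb), hb⟩)
    · by_cases hbT : b ∈ T
      · rw [← hAB] at hbT
        exact hAorth a ha b (hbT.resolve_left hb.2)
      · exact horth a (hAT ha) b ⟨hb.1, hbT⟩
  rintro ⟨A, B, hAB, hinter, hA, hB, hAorth⟩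
  rcases (hAB ▸ hψT : ψ ∈ A ∪ B) with h | h
  · exact key A B hAB hinter hB hAorth h
  · exact key B A (Set.union_comm A B ▸ hAB) (Set.inter_comm A B ▸ hinter) hA
      (fun a ha b hb => by rw [real_inner_comm]; exact hAorth b hb a ha) h

end components

theorem inner_eq_zero_of_mem_span {V : Type*} [NormedAddCommGroup V] [InnerProductSpace ℝ V]
    {K : Set V} {x y : V} (hx : x ∈ Submodule.span ℝ K) (h : ∀ α ∈ K, ⟪α, y⟫_ℝ = 0) :
    ⟪x, y⟫_ℝ = 0 := by
  induction hx using Submodule.span_induction with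
  | mem α hα => exact h α hα
  | zero => exact inner_zero_left y
  | add u v _ _ hu hv => rw [inner_add_left, hu, hv, add_zero]
  | smul t u _ hu => rw [real_inner_smul_left, hu, mul_zero]

namespace RootSystemData

variable {V : Type*} [NormedAddCommGroup V] [InnerProductSpace ℝ V] (R : RootSystemData V)

/-- The roots in the span of a set of vectors. -/
def levi (J : Set V) : Set V := {ψ ∈ R.Δ | ψ ∈ Submodule.span ℝ J}

theorem levi_simple : R.levi R.Simple = R.Δ := by
  refine Set.Subset.antisymm (fun _ h => h.1) fun φ h => ⟨h, ?_⟩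
  have := R.span_simple (Submodule.mem_top (x := φ))
  rwa [Subtype.range_coe] at this

theorem neg_mem_levi {J : Set V} {φ : V} (h : φ ∈ R.levi J) : -φ ∈ R.levi J :=
  ⟨R.neg_mem φ h.1, Submodule.neg_mem _ h.2⟩

theorem levi_mono {J K : Set V} (h : J ⊆ K) : R.levi J ⊆ R.levi K :=
  fun _ hφ => ⟨hφ.1, Submodule.span_mono h hφ.2⟩

theorem subset_levi {J : Set V} (hJ : J ⊆ R.Simple) : J ⊆ R.levi J :=
  fun _ hα => ⟨R.mem_of_pos (hJ hα).1, Submodule.subset_span hα⟩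

theorem mem_span_of_add_mem_span {J : Set V} (hJ : J ⊆ R.Simple) {φ ψ : V} (hφ : φ ∈ R.cone)
    (hψ : ψ ∈ R.cone) (h : φ + ψ ∈ Submodule.span ℝ J) : φ ∈ Submodule.span ℝ J := by
  rw [R.mem_span_iff hJ] at h ⊢
  intro α hα
  have h0 := h α hα
  rw [map_add] at h0
  linarith [R.coord_nonneg_of_mem_cone α hφ, R.coord_nonneg_of_mem_cone α hψ]

theorem pos_levi_split {J K : Set V} (hJ : J ⊆ R.Simple) (hK : K ⊆ R.Simple)
    (horth : ∀ a ∈ J, ∀ b ∈ K, ⟪a, b⟫_ℝ = 0) :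
    ∀ φ ∈ R.Pos, φ ∈ Submodule.span ℝ (J ∪ K) →
      φ ∈ Submodule.span ℝ J ∨ φ ∈ Submodule.span ℝ K := by
  have hJK : J ∪ K ⊆ R.Simple := Set.union_subset hJ hK
  have mixed : ∀ β ∈ R.Pos, ∀ γ ∈ R.Pos, β + γ ∈ R.Δ → β ∈ Submodule.span ℝ J →
      γ ∈ Submodule.span ℝ K → False := by
    intro β hβ γ hγ hadd hβJ hγK
    have hβγ : ∀ γ ∈ Submodule.span ℝ K, ⟪β, γ⟫_ℝ = 0 := fun γ hγ =>
      inner_eq_zero_of_mem_span hβJ fun a ha => by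
        rw [real_inner_comm]
        exact inner_eq_zero_of_mem_span hγ fun b hb => by
          rw [real_inner_comm]
          exact horth a ha b hb
    have hsub : β - γ ∈ R.Δ := by
      have := R.reflect_mem _ hadd γ (R.mem_of_pos hγ)
      rw [inner_add_left, hβγ γ hγK, zero_add,
        mul_div_cancel_right₀ _ (R.inner_self_pos (R.mem_of_pos hγ)).ne'] at this
      convert this using 1
      module
    rcases R.mem_or_neg _ hsub with h | h
    · have hmem : γ ∈ Submodule.span ℝ J :=
        R.mem_span_of_add_mem_span hJ (R.mem_cone_of_pos hγ) (R.mem_cone_of_pos h) (by simpa)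
      refine (R.inner_self_pos (R.mem_of_pos hγ)).ne'
        (inner_eq_zero_of_mem_span hmem fun a ha => ?_)
      rw [real_inner_comm]
      exact inner_eq_zero_of_mem_span hγK fun b hb => by
        rw [real_inner_comm]
        exact horth a ha b hb
    · have hmem : β ∈ Submodule.span ℝ K :=
        R.mem_span_of_add_mem_span hK (R.mem_cone_of_pos hβ) (R.mem_cone_of_pos h) (by simpa)
      exact (R.inner_self_pos (R.mem_of_pos hβ)).ne' (hβγ β hmem)
  refine R.pos_induction (fun α hα h => ?_) fun β hβ γ hγ hadd ihβ ihγ h => ?_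
  · have hmem : α ∈ J ∪ K := by
      by_contra hα'
      have := (R.mem_span_iff hJK).mp h ⟨α, hα⟩ hα'
      rw [R.coord_self ⟨α, hα⟩] at this
      exact one_ne_zero this
    exact hmem.imp (fun h => Submodule.subset_span h) (fun h => Submodule.subset_span h)
  · have hβ' := ihβ (R.mem_span_of_add_mem_span hJK (R.mem_cone_of_pos hβ) (R.mem_cone_of_pos hγ) h)
    have hγ' := ihγ (R.mem_span_of_add_mem_span hJK (R.mem_cone_of_pos hγ) (R.mem_cone_of_pos hβ)
      (add_comm β γ ▸ h))
    have haddΔ := R.mem_of_pos hadd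
    rcases hβ' with h1 | h1 <;> rcases hγ' with h2 | h2
    · exact Or.inl (add_mem h1 h2)
    · exact (mixed β hβ γ hγ haddΔ h1 h2).elim
    · exact (mixed γ hγ β hβ (add_comm β γ ▸ haddΔ) h2 h1).elim
    · exact Or.inr (add_mem h1 h2)

theorem levi_split {J K : Set V} (hJ : J ⊆ R.Simple) (hK : K ⊆ R.Simple)
    (horth : ∀ a ∈ J, ∀ b ∈ K, ⟪a, b⟫_ℝ = 0) {φ : V} (hφ : φ ∈ R.levi (J ∪ K)) :
    φ ∈ R.levi J ∨ φ ∈ R.levi K := by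
  rcases R.mem_or_neg φ hφ.1 with h | h
  · exact (R.pos_levi_split hJ hK horth φ h hφ.2).imp (⟨hφ.1, ·⟩) (⟨hφ.1, ·⟩)
  · have := R.pos_levi_split hJ hK horth _ h (Submodule.neg_mem _ hφ.2)
    rw [Submodule.neg_mem_iff, Submodule.neg_mem_iff] at this
    exact this.imp (⟨hφ.1, ·⟩) (⟨hφ.1, ·⟩)

theorem component_levi {J C : Set V} (hJ : J ⊆ R.Simple) (hC : IsComponent (R.levi J) C) :
    C = R.levi (J ∩ C) := by
  have hsub := R.subset_levi hJ
  have horth : ∀ a ∈ J ∩ C, ∀ b ∈ J \ C, ⟪a, b⟫_ℝ = 0 := fun a ha b hb =>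
    hC.2.2 a ha.2 b ⟨hsub hb.1, hb.2⟩
  have hself : ∀ φ ∈ R.Δ, ⟪φ, φ⟫_ℝ ≠ 0 := fun φ hφ => (R.inner_self_pos hφ).ne'
  refine Set.Subset.antisymm (fun φ hφ => ?_) fun φ hφ => ?_
  · have hφJ := hC.1 hφ
    rw [← Set.inter_union_sdiff J C] at hφJ
    refine (R.levi_split (Set.inter_subset_left.trans hJ) (Set.sdiff_subset.trans hJ) horth
      hφJ).resolve_right fun h => hself φ hφJ.1 ?_
    refine inner_eq_zero_of_mem_span h.2 fun b hb => ?_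
    rw [real_inner_comm]
    exact hC.2.2 φ hφ b ⟨hsub hb.1, hb.2⟩
  · by_contra hφC
    refine hself φ hφ.1 (inner_eq_zero_of_mem_span hφ.2 fun a ha => ?_)
    exact hC.2.2 a ha.2 φ ⟨R.levi_mono Set.inter_subset_left hφ, hφC⟩

end RootSystemData

namespace RootSystemData

variable {V : Type*} [NormedAddCommGroup V] [InnerProductSpace ℝ V] (R : RootSystemData V)
  {J : Set V} {β : V}

theorem eq_zero_of_height_nonpos {ℓ : V →ₗ[ℝ] ℝ} (hℓ : ∀ φ ∈ R.Pos, 0 < ℓ φ) {x : V}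
    (hx : x ∈ R.cone) (h : ℓ x ≤ 0) : x = 0 := by
  have key : x = 0 ∨ 0 < ℓ x := by
    clear h
    induction hx using AddSubmonoid.closure_induction with
    | mem φ hφ => exact Or.inr (hℓ φ hφ)
    | zero => exact Or.inl rfl
    | add x y _ _ hx hy =>
      rcases hx with rfl | hx
      · rwa [zero_add]
      rcases hy with rfl | hy
      · rw [add_zero]
        exact Or.inr hx
      · rw [map_add]
        exact Or.inr (add_pos hx hy)
  exact key.resolve_right h.not_gt

/-- A positive root of a set of roots which is maximal for the order given by `R.cone`. -/
def IsMaximal (S : Set V) (β : V) : Prop :=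
  β ∈ S ∧ β ∈ R.Pos ∧ ∀ ψ ∈ S, ψ ∈ R.Pos → ψ - β ∈ R.cone → ψ = β

theorem IsHighest.isMaximal {S : Set V} (h : R.IsHighest S β) : R.IsMaximal S β := by
  refine ⟨h.1, h.2.1, fun ψ hψ _ hc => sub_eq_zero.mp (R.eq_zero_of_mem_cone hc ?_)⟩
  rw [neg_sub]
  exact R.nonnegComb_iff.mp (h.2.2 ψ hψ)

theorem exists_isMaximal {S : Set V} {φ : V} (hφS : φ ∈ S) (hφ : φ ∈ R.Pos) :
    ∃ β, R.IsMaximal S β ∧ β - φ ∈ R.cone := by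
  obtain ⟨ℓ, hℓ⟩ := R.exists_height
  obtain ⟨β, ⟨hβS, hβ, hβφ⟩, hmax⟩ :=
    Set.exists_max_image {ψ | ψ ∈ S ∧ ψ ∈ R.Pos ∧ ψ - φ ∈ R.cone} ℓ
    (R.finite_pos.subset fun _ h => h.2.1)
    ⟨φ, hφS, hφ, by rw [sub_self]; exact zero_mem _⟩
  refine ⟨β, ⟨hβS, hβ, fun ψ hψS hψ hc => sub_eq_zero.mp
    (R.eq_zero_of_height_nonpos hℓ hc ?_)⟩, hβφ⟩
  rw [map_sub]
  refine sub_nonpos.mpr (hmax ψ ⟨hψS, hψ, ?_⟩)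
  rw [← sub_add_sub_cancel ψ β φ]
  exact add_mem hc hβφ

theorem IsMaximal.inner_nonneg (h : R.IsMaximal (R.levi J) β) {ψ : V} (hψJ : ψ ∈ R.levi J)
    (hψ : ψ ∈ R.Pos) : 0 ≤ ⟪ψ, β⟫_ℝ := by
  by_contra! hneg
  have hmem := R.add_mem_of_inner_neg hψJ.1 h.1.1 hneg (R.ne_neg_of_pos hψ h.2.1)
  have := h.2.2 _ ⟨hmem, add_mem hψJ.2 h.1.2⟩ (R.pos_add ψ hψ β h.2.1 hmem) (by
    rw [add_sub_cancel_right]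
    exact R.mem_cone_of_pos hψ)
  exact R.ne_zero_of_mem hψJ.1 (add_eq_right.mp this)

theorem coord_eq_zero_of_notMem (hJ : J ⊆ R.Simple) (hβ : β ∈ R.levi J) {α : R.Simple}
    (hα : (α : V) ∉ J) : R.simpleBasis.coord α β = 0 :=
  (R.mem_span_iff hJ).mp hβ.2 α hα

theorem IsMaximal.subset_support (hJ : J ⊆ R.Simple) (hirr : IsIrred (R.levi J))
    (h : R.IsMaximal (R.levi J) β) : J ⊆ R.support β := by
  set K := J ∩ R.support β with hK
  set K' := J \ R.support β with hK'
  have hJK : K ∪ K' = J := Set.inter_union_sdiff _ _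
  have hKs : K ⊆ R.Simple := Set.inter_subset_left.trans hJ
  have hKs' : K' ⊆ R.Simple := Set.sdiff_subset.trans hJ
  have horth : ∀ a ∈ K, ∀ b ∈ K', ⟪a, b⟫_ℝ = 0 := by
    intro a ha b hb
    have hnonneg := h.inner_nonneg R (R.subset_levi hJ hb.1) (hKs' hb).1
    rw [real_inner_comm, R.inner_eq_sum_coord_mul_inner] at hnonneg
    have hterm : ∀ α ∈ (R.simpleBasis.repr β).support,
        R.simpleBasis.repr β α * ⟪(α : V), b⟫_ℝ ≤ 0 := by
      intro α hα
      refine mul_nonpos_of_nonneg_of_nonpos (R.coord_nonneg α h.2.1)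
        (R.inner_simple_nonpos α.2 (hKs' hb) ?_)
      rintro rfl
      exact hb.2 ((R.mem_support_iff α).mpr (Finsupp.mem_support_iff.mp hα))
    have hzero := (Finset.sum_eq_zero_iff_of_nonpos hterm).mp
      (le_antisymm (Finset.sum_nonpos hterm) hnonneg)
    have ha' := (R.mem_support_iff ⟨a, hKs ha⟩).mp ha.2
    exact (mul_eq_zero.mp (hzero ⟨a, hKs ha⟩ (Finsupp.mem_support_iff.mpr ha'))).resolve_left ha'
  have hβK : β ∈ R.levi K := by
    refine ⟨h.1.1, (R.mem_span_iff hKs).mpr fun α hα => ?_⟩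
    by_contra h0
    refine hα ⟨?_, (R.mem_support_iff α).mpr h0⟩
    by_contra hαJ
    exact h0 (R.coord_eq_zero_of_notMem hJ h.1 hαJ)
  have hlevi : R.levi K ∪ R.levi K' = R.levi J := by
    refine Set.Subset.antisymm (Set.union_subset (R.levi_mono Set.inter_subset_left)
      (R.levi_mono Set.sdiff_subset)) fun φ hφ => ?_
    rw [← hJK] at hφ
    exact R.levi_split hKs hKs' horth hφ
  have hself : ∀ x ∈ R.levi K, ∀ y ∈ R.levi K', ⟪x, y⟫_ℝ = 0 := fun x hx y hy =>
    inner_eq_zero_of_mem_span hx.2 fun a ha => by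
      rw [real_inner_comm]
      exact inner_eq_zero_of_mem_span hy.2 fun b hb => by
        rw [real_inner_comm]
        exact horth a ha b hb
  rw [← hlevi] at hirr
  have hdisj : R.levi K ∩ R.levi K' = ∅ :=
    Set.eq_empty_of_forall_notMem fun x hx => (R.inner_self_pos hx.1.1).ne' (hself x hx.1 x hx.2)
  have hsub := hirr.subset_left ⟨β, hβK⟩ hdisj hself
  intro α hα
  by_contra hα'
  have hαK : α ∈ R.levi K' := R.subset_levi hKs' ⟨hα, hα'⟩
  exact Set.notMem_empty α (hdisj ▸ ⟨hsub (Or.inr hαK), hαK⟩)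

theorem IsMaximal.eq (hJ : J ⊆ R.Simple) (hirr : IsIrred (R.levi J))
    (h : R.IsMaximal (R.levi J) β) {β' : V} (h' : R.IsMaximal (R.levi J) β') : β = β' := by
  by_contra hne
  have hterm : ∀ α ∈ (R.simpleBasis.repr β).support,
      0 ≤ R.simpleBasis.repr β α * ⟪(α : V), β'⟫_ℝ := by
    intro α hα
    refine mul_nonneg (R.coord_nonneg α h.2.1) (h'.inner_nonneg R (R.subset_levi hJ ?_) α.2.1)
    by_contra hαJ
    exact Finsupp.mem_support_iff.mp hα (R.coord_eq_zero_of_notMem hJ h.1 hαJ)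
  have hinner := R.inner_eq_sum_coord_mul_inner β β'
  rcases (Finset.sum_nonneg hterm).eq_or_lt with h0 | hpos
  · have hzero := (Finset.sum_eq_zero_iff_of_nonneg hterm).mp h0.symm
    refine (R.inner_self_pos h'.1.1).ne' (inner_eq_zero_of_mem_span h'.1.2 fun a ha => ?_)
    have ha' := (R.mem_support_iff ⟨a, hJ ha⟩).mp (h.subset_support R hJ hirr ha)
    exact (mul_eq_zero.mp (hzero ⟨a, hJ ha⟩ (Finsupp.mem_support_iff.mpr ha'))).resolve_left ha'
  · have hmem := R.sub_mem_of_inner_pos h.1.1 h'.1.1 (hinner ▸ hpos) hne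
    rcases R.mem_or_neg _ hmem with hp | hp
    · exact hne (h'.2.2 β h.1 h.2.1 (R.mem_cone_of_pos hp))
    · rw [neg_sub] at hp
      exact hne (h.2.2 β' h'.1 h'.2.1 (R.mem_cone_of_pos hp)).symm

theorem exists_isHighest (hJ : J ⊆ R.Simple) (hirr : IsIrred (R.levi J)) :
    ∃ β, R.IsHighest (R.levi J) β := by
  obtain ⟨φ, hφJ, hφ⟩ : ∃ φ ∈ R.levi J, φ ∈ R.Pos := by
    obtain ⟨φ, hφ⟩ := hirr.1
    rcases R.mem_or_neg φ hφ.1 with h | h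
    · exact ⟨φ, hφ, h⟩
    · exact ⟨-φ, R.neg_mem_levi hφ, h⟩
  obtain ⟨β, hβ, -⟩ := R.exists_isMaximal hφJ hφ
  refine ⟨β, hβ.1, hβ.2.1, fun ψ hψ => R.nonnegComb_iff.mpr ?_⟩
  rcases R.mem_or_neg ψ hψ.1 with h | h
  · obtain ⟨β', hβ', hc⟩ := R.exists_isMaximal hψ h
    rwa [hβ.eq R hJ hirr hβ']
  · rw [sub_eq_add_neg]
    exact add_mem (R.mem_cone_of_pos hβ.2.1) (R.mem_cone_of_pos h)

theorem IsHighest.support_eq (hJ : J ⊆ R.Simple) (h : R.IsHighest (R.levi J) β) :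
    R.support β = J := by
  ext α
  constructor
  · intro hα
    by_contra hαJ
    exact (R.mem_support_iff ⟨α, hα.1⟩).mp hα (R.coord_eq_zero_of_notMem hJ h.1 hαJ)
  · intro hα
    refine (R.mem_support_iff ⟨α, hJ hα⟩).mpr fun h0 => ?_
    have := R.coord_nonneg_of_mem_cone ⟨α, hJ hα⟩
      (R.nonnegComb_iff.mp (h.2.2 α (R.subset_levi hJ hα)))
    rw [map_sub, h0, R.coord_self ⟨α, hJ hα⟩] at this
    norm_num at this

theorem IsHighest.sub_eq (hJ : J ⊆ R.Simple) (h : R.IsHighest (R.levi J) β) :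
    R.sub β = R.levi J := by
  unfold sub levi
  rw [h.support_eq R hJ]

theorem IsHighest.orth_eq (hJ : J ⊆ R.Simple) (h : R.IsHighest (R.levi J) β) :
    R.orth β = R.levi {α ∈ J | ⟪α, β⟫_ℝ = 0} := by
  have hsub : {α ∈ J | ⟪α, β⟫_ℝ = 0} ⊆ R.Simple := fun α hα => hJ hα.1
  have hpos : ∀ φ ∈ R.levi J, φ ∈ R.Pos → ⟪φ, β⟫_ℝ = 0 →
      φ ∈ R.levi {α ∈ J | ⟪α, β⟫_ℝ = 0} := by
    intro φ hφJ hφ h0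
    have hterm : ∀ α ∈ (R.simpleBasis.repr φ).support,
        0 ≤ R.simpleBasis.repr φ α * ⟪(α : V), β⟫_ℝ := by
      intro α hα
      refine mul_nonneg (R.coord_nonneg α hφ)
        ((IsHighest.isMaximal R h).inner_nonneg R (R.subset_levi hJ ?_) α.2.1)
      by_contra hαJ
      exact Finsupp.mem_support_iff.mp hα (R.coord_eq_zero_of_notMem hJ hφJ hαJ)
    rw [R.inner_eq_sum_coord_mul_inner] at h0
    have hzero := (Finset.sum_eq_zero_iff_of_nonneg hterm).mp h0
    refine ⟨hφJ.1, (R.mem_span_iff hsub).mpr fun α hα => ?_⟩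
    by_contra hne
    refine hα ⟨?_, ?_⟩
    · by_contra hαJ
      exact hne (R.coord_eq_zero_of_notMem hJ hφJ hαJ)
    · exact (mul_eq_zero.mp (hzero α (Finsupp.mem_support_iff.mpr hne))).resolve_left hne
  unfold orth
  rw [h.sub_eq R hJ]
  ext φ
  constructor
  · rintro ⟨hφJ, h0⟩
    rcases R.mem_or_neg φ hφJ.1 with hφ | hφ
    · exact hpos φ hφJ hφ h0
    · rw [← neg_neg φ]
      exact R.neg_mem_levi (hpos _ (R.neg_mem_levi hφJ) hφ (by rw [inner_neg_left, h0, neg_zero]))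
  · exact fun hφ => ⟨R.levi_mono (fun α hα => hα.1) hφ,
      inner_eq_zero_of_mem_span hφ.2 fun α hα => hα.2⟩

theorem IsHighest.inner_pos_of_add (hJ : J ⊆ R.Simple) (h : R.IsHighest (R.levi J) β) {ψ χ : V}
    (hψ : ψ ∈ R.Pos) (hχ : χ ∈ R.Pos) (hadd : β = ψ + χ) : ψ ∈ R.levi J ∧ 0 < ⟪ψ, β⟫_ℝ := by
  have hψJ : ψ ∈ R.levi J := ⟨R.mem_of_pos hψ, R.mem_span_of_add_mem_span hJ
    (R.mem_cone_of_pos hψ) (R.mem_cone_of_pos hχ) (hadd ▸ h.1.2)⟩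
  refine ⟨hψJ, lt_of_le_of_ne ((IsHighest.isMaximal R h).inner_nonneg R hψJ hψ) fun h0 => ?_⟩
  have hψψ := R.inner_self_pos hψJ.1
  have hχψ : ⟪χ, ψ⟫_ℝ = -⟪ψ, ψ⟫_ℝ := by
    rw [hadd, inner_add_right, real_inner_comm] at h0
    linarith [real_inner_comm χ ψ]
  have hmem := R.reflect_mem χ (R.mem_of_pos hχ) ψ hψJ.1
  rw [hχψ, mul_neg, neg_div, mul_div_cancel_right₀ _ hψψ.ne'] at hmem
  have hmem' : β + ψ ∈ R.Δ := by
    convert hmem using 1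
    rw [hadd]
    module
  have := R.nonnegComb_iff.mp (h.2.2 (β + ψ) ⟨hmem', add_mem h.1.2 hψJ.2⟩)
  rw [sub_add_cancel_left] at this
  exact R.neg_notMem_cone hψ this

theorem IsHighest.sub_mem_pos {S : Set V} (h : R.IsHighest S β) {ψ : V} (hψS : ψ ∈ S)
    (hψ : ψ ∈ R.Pos) (hinner : 0 < ⟪ψ, β⟫_ℝ) (hne : ψ ≠ β) : β - ψ ∈ R.Pos := by
  have hmem := R.sub_mem_of_inner_pos (R.mem_of_pos hψ) (R.mem_of_pos h.2.1) hinner hne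
  rcases R.mem_or_neg _ hmem with hp | hp
  · have := R.nonnegComb_iff.mp (h.2.2 ψ hψS)
    rw [← neg_sub] at this
    exact absurd this (R.neg_notMem_cone hp)
  · rwa [neg_sub] at hp

end RootSystemData

namespace RootSystemData

variable {V : Type*} [NormedAddCommGroup V] [InnerProductSpace ℝ V] (R : RootSystemData V)

/-- `R.IsNode S C β`: the root `β` is the highest root of the irreducible component `C` of `S`,
where `S` is either the set of all roots or `R.orth γ` for a root `γ` obtained in the same way. -/
inductive IsNode : Set V → Set V → V → Prop
  | root {C : Set V} {β : V} : IsComponent R.Δ C → R.IsHighest C β → IsNode R.Δ C β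
  | child {S C C' : Set V} {γ β : V} : IsNode S C γ → IsComponent (R.orth γ) C' →
      R.IsHighest C' β → IsNode (R.orth γ) C' β

variable {R} {S S' C C' : Set V} {β β' : V}

theorem IsNode.isComponent (h : R.IsNode S C β) : IsComponent S C := by
  cases h <;> assumption

theorem IsNode.isHighest (h : R.IsNode S C β) : R.IsHighest C β := by
  cases h <;> assumption

theorem IsNode.exists_levi (h : R.IsNode S C β) :
    ∃ J ⊆ R.Simple, C = R.levi J := by
  induction h with
  | root hC hβ =>
    rw [← R.levi_simple] at hC
    exact ⟨_, Set.inter_subset_left, R.component_levi subset_rfl hC⟩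
  | child hγ hC hβ ih =>
    obtain ⟨J, hJ, rfl⟩ := ih
    have hsub : ∀ p : V → Prop, {α ∈ J | p α} ⊆ R.Simple := fun p α hα => hJ hα.1
    rw [IsHighest.orth_eq R hJ hγ.isHighest] at hC
    exact ⟨_, Set.inter_subset_left.trans (hsub _), R.component_levi (hsub _) hC⟩

theorem IsNode.sub_eq (h : R.IsNode S C β) : R.sub β = C := by
  obtain ⟨J, hJ, rfl⟩ := h.exists_levi
  exact IsHighest.sub_eq R hJ h.isHighest

theorem IsNode.orth_subset (h : R.IsNode S C β) : R.orth β ⊆ C := fun _ hφ => h.sub_eq ▸ hφ.1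

theorem IsNode.notMem_orth (h : R.IsNode S C β) : β ∉ R.orth β := fun h' =>
  (R.inner_self_pos (R.mem_of_pos h.isHighest.2.1)).ne' h'.2

theorem IsHighest.unique (h : R.IsHighest C β) (h' : R.IsHighest C β') : β = β' :=
  sub_eq_zero.mp (R.eq_zero_of_mem_cone (R.nonnegComb_iff.mp (h.2.2 β' h'.1))
    (by rw [neg_sub]; exact R.nonnegComb_iff.mp (h'.2.2 β h.1)))

theorem IsNode.subset_Δ (h : R.IsNode S C β) : C ⊆ R.Δ := by
  obtain ⟨J, -, rfl⟩ := h.exists_levi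
  exact fun φ hφ => hφ.1

/-- Two nodes with components `C` and `C'` and highest roots `β` and `β'` are comparable. -/
def NodesRelated (R : RootSystemData V) (C : Set V) (β : V) (C' : Set V) (β' : V) : Prop :=
  (C = C' ∧ β = β') ∨ C ⊆ R.orth β' ∨ C' ⊆ R.orth β ∨ ∀ a ∈ C, ∀ b ∈ C', ⟪a, b⟫_ℝ = 0

theorem NodesRelated.symm (h : NodesRelated R C β C' β') : NodesRelated R C' β' C β := by
  rcases h with ⟨rfl, rfl⟩ | h | h | h
  · exact Or.inl ⟨rfl, rfl⟩
  · exact Or.inr (Or.inr (Or.inl h))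
  · exact Or.inr (Or.inl h)
  · exact Or.inr (Or.inr (Or.inr fun a ha b hb => by rw [real_inner_comm]; exact h b hb a ha))

theorem nodesRelated_of_isComponent (hC : IsComponent S C) (hC' : IsComponent S C')
    (hβ : R.IsHighest C β) (hβ' : R.IsHighest C' β') : NodesRelated R C β C' β' := by
  rcases hC.eq_or_orthogonal hC' with rfl | h
  · exact Or.inl ⟨rfl, hβ.unique hβ'⟩
  · exact Or.inr (Or.inr (Or.inr h))

/-- A component of `S` cannot be contained in the proper part `R.orth γ` of an irreducible subset
`D` of `S`. -/
theorem not_subset_orth_of_isComponent {T D : Set V} {γ : V} (hC : IsComponent S C)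
    (hD : R.IsNode T D γ) (hDS : D ⊆ S) : ¬ C ⊆ R.orth γ := by
  intro hsub
  obtain ⟨x, hx⟩ := hC.2.1.1
  have := hC.subset_of_isIrred hD.isComponent.2.1 hDS ⟨x, hD.orth_subset (hsub hx), hx⟩
  exact hD.notMem_orth (hsub (this hD.isHighest.1))

theorem nodesRelated_of_parent {D : Set V} {γ : V} (h : R.IsNode S D γ) (hC : C ⊆ R.orth γ)
    (hrel : NodesRelated R D γ C' β') (hnot : C' ⊆ R.orth γ → NodesRelated R C β C' β') :
    NodesRelated R C β C' β' := by
  have hCD : C ⊆ D := hC.trans h.orth_subset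
  rcases hrel with ⟨rfl, rfl⟩ | h | h | h
  · exact Or.inr (Or.inl hC)
  · exact Or.inr (Or.inl (hCD.trans h))
  · exact hnot h
  · exact Or.inr (Or.inr (Or.inr fun a ha b hb => h a (hCD ha) b hb))

theorem nodesRelated_root (hC : IsComponent R.Δ C) (hβ : R.IsHighest C β)
    (h' : R.IsNode S' C' β') : NodesRelated R C β C' β' := by
  induction h' with
  | root hC' hβ' => exact nodesRelated_of_isComponent hC hC' hβ hβ'
  | child hγ hC' hβ' ih =>
    exact (nodesRelated_of_parent hγ hC'.1 ih.symm fun hsub =>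
      absurd hsub (not_subset_orth_of_isComponent hC hγ hγ.subset_Δ)).symm

theorem IsNode.nodesRelated (h : R.IsNode S C β) (h' : R.IsNode S' C' β') :
    NodesRelated R C β C' β' := by
  induction h generalizing S' C' β' with
  | root hC hβ => exact nodesRelated_root hC hβ h'
  | @child S D C γ β hγ hC hβ ih =>
    induction h' with
    | root hC' hβ' => exact (nodesRelated_root hC' hβ' (hγ.child hC hβ)).symm
    | @child S' D' C' γ' β' hγ' hC' hβ' ih' =>
      refine nodesRelated_of_parent hγ hC.1 (ih (hγ'.child hC' hβ')) fun hsub => ?_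
      refine (nodesRelated_of_parent hγ' hC'.1 ih'.symm fun hsub' => ?_).symm
      rcases ih hγ' with ⟨-, rfl⟩ | h | h | h
      · exact (nodesRelated_of_isComponent hC hC' hβ hβ').symm
      · exact absurd hsub (not_subset_orth_of_isComponent hC' hγ h)
      · exact absurd hsub' (not_subset_orth_of_isComponent hC hγ' h)
      · obtain ⟨x, hx⟩ := hC.2.1.1
        have := h x (hγ.orth_subset (hC.1 hx)) x (hγ'.orth_subset (hsub' hx))
        exact absurd this (R.inner_self_pos (hC.1 hx).1.1).ne'

theorem mem_cascade_iff : β ∈ R.cascade ↔ ∃ S C, R.IsNode S C β := by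
  constructor
  · rintro ⟨l, ⟨-, hhead, hchain⟩, hβ⟩
    have key : ∀ l : List V, (∀ b ∈ l.head?, ∃ S C, R.IsNode S C b) →
        l.IsChain (fun γ δ => ∃ C, IsComponent (R.orth γ) C ∧ R.IsHighest C δ) →
        ∀ b ∈ l, ∃ S C, R.IsNode S C b := by
      intro l
      induction l with
      | nil => simp
      | cons a l ih =>
        intro hhead hchain b hb
        have ha := hhead a rfl
        rcases List.mem_cons.mp hb with rfl | hb
        · exact ha
        · rw [List.isChain_cons] at hchain
          refine ih (fun c hc => ?_) hchain.2 b hb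
          obtain ⟨C', hC', hc'⟩ := hchain.1 c hc
          obtain ⟨S, C, hnode⟩ := ha
          exact ⟨_, C', hnode.child hC' hc'⟩
    refine key l (fun b hb => ?_) hchain β hβ
    obtain ⟨C, hC, hb⟩ := hhead b hb
    exact ⟨_, C, .root hC hb⟩
  · rintro ⟨S, C, h⟩
    suffices ∃ l, R.IsChainCascade l ∧ β ∈ l.getLast? by
      obtain ⟨l, hl, hβ⟩ := this
      exact ⟨l, hl, List.mem_of_mem_getLast? hβ⟩
    induction h with
    | @root C β hC hβ =>
      exact ⟨[β], ⟨by simp, by simpa using ⟨C, hC, hβ⟩, List.isChain_singleton _⟩, rfl⟩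
    | @child S C C' γ β hγ hC hβ ih =>
      obtain ⟨l, ⟨hne, hhead, hchain⟩, hlast⟩ := ih
      refine ⟨l ++ [β], ⟨by simp, fun b hb => hhead b ?_, ?_⟩, by simp⟩
      · rwa [List.head?_append_of_ne_nil _ hne] at hb
      · refine List.isChain_append.mpr ⟨hchain, List.isChain_singleton _, fun x hx y hy => ?_⟩
        rw [Option.mem_unique hx hlast]
        rw [List.head?_cons, Option.mem_some_iff] at hy
        exact hy ▸ ⟨C', hC, hβ⟩

theorem pos_of_mem_cascade (h : β ∈ R.cascade) : β ∈ R.Pos := by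
  obtain ⟨S, C, hnode⟩ := mem_cascade_iff.mp h
  exact hnode.isHighest.2.1

theorem inner_eq_zero_of_mem_cascade (h : β ∈ R.cascade) (h' : β' ∈ R.cascade) (hne : β ≠ β') :
    ⟪β, β'⟫_ℝ = 0 := by
  obtain ⟨S, C, hnode⟩ := mem_cascade_iff.mp h
  obtain ⟨S', C', hnode'⟩ := mem_cascade_iff.mp h'
  rcases hnode.nodesRelated hnode' with ⟨-, heq⟩ | hsub | hsub | horth
  · exact absurd heq hne
  · exact (hsub hnode.isHighest.1).2
  · rw [real_inner_comm]
    exact (hsub hnode'.isHighest.1).2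
  · exact horth β hnode.isHighest.1 β' hnode'.isHighest.1

theorem IsNode.inner_pos_of_add (h : R.IsNode S C β) {ψ χ : V} (hψ : ψ ∈ R.Pos) (hχ : χ ∈ R.Pos)
    (hadd : β = ψ + χ) : ψ ∈ C ∧ 0 < ⟪ψ, β⟫_ℝ := by
  obtain ⟨J, hJ, rfl⟩ := h.exists_levi
  exact IsHighest.inner_pos_of_add R hJ h.isHighest hψ hχ hadd

theorem cascade_partner_unique {ψ χ χ' : V} (hψ : ψ ∈ R.Pos) (hχ : χ ∈ R.Pos) (hχ' : χ' ∈ R.Pos)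
    (h : β ∈ R.cascade) (h' : β' ∈ R.cascade) (hadd : β = ψ + χ) (hadd' : β' = ψ + χ') :
    χ = χ' := by
  obtain ⟨S, C, hnode⟩ := mem_cascade_iff.mp h
  obtain ⟨S', C', hnode'⟩ := mem_cascade_iff.mp h'
  obtain ⟨hψC, hpos⟩ := hnode.inner_pos_of_add hψ hχ hadd
  obtain ⟨hψC', hpos'⟩ := hnode'.inner_pos_of_add hψ hχ' hadd'
  rcases hnode.nodesRelated hnode' with ⟨-, heq⟩ | hsub | hsub | horth
  · rw [hadd, hadd'] at heq
    exact add_left_cancel heq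
  · exact absurd (hsub hψC).2 hpos'.ne'
  · exact absurd (hsub hψC').2 hpos.ne'
  · exact absurd (horth ψ hψC ψ hψC') (R.inner_self_pos (R.mem_of_pos hψ)).ne'

theorem cascade_add_ne {φ : V} (h : β ∈ R.cascade) (h' : β' ∈ R.cascade) (hφ : φ ∈ R.Pos) :
    β' ≠ β + φ := by
  intro hadd
  obtain ⟨S', C', hnode'⟩ := mem_cascade_iff.mp h'
  have hpos := (hnode'.inner_pos_of_add (pos_of_mem_cascade h) hφ hadd).2
  refine hpos.ne' (inner_eq_zero_of_mem_cascade h h' ?_)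
  rintro rfl
  exact R.ne_zero_of_mem (R.mem_of_pos hφ) (left_eq_add.mp hadd)

theorem exists_node_inner_pos {T J : Set V} (hJ : J ⊆ R.Simple) (hTJ : T = R.levi J)
    (hT : ∀ C β, IsComponent T C → R.IsHighest C β → R.IsNode T C β) {ψ : V} (hψT : ψ ∈ T)
    (hψ : ψ ∈ R.Pos) : ∃ S C β, R.IsNode S C β ∧ ψ ∈ C ∧ 0 < ⟪ψ, β⟫_ℝ := by
  induction hn : T.ncard using Nat.strong_induction_on generalizing T J with
  | _ n ih =>
    have hTfin : T.Finite := by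
      rw [hTJ]
      exact R.finite.subset fun _ h => h.1
    obtain ⟨C, hC, hψC⟩ := exists_isComponent hTfin hψT
    have hCJ : C = R.levi (J ∩ C) := R.component_levi hJ (hTJ ▸ hC)
    have hJC : J ∩ C ⊆ R.Simple := Set.inter_subset_left.trans hJ
    obtain ⟨β, hβ⟩ := R.exists_isHighest hJC (hCJ ▸ hC.2.1)
    rw [← hCJ] at hβ
    have hnode := hT C β hC hβ
    have hnonneg : 0 ≤ ⟪ψ, β⟫_ℝ :=
      IsMaximal.inner_nonneg R (IsHighest.isMaximal R (hCJ ▸ hβ)) (hCJ ▸ hψC) hψ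
    rcases hnonneg.eq_or_lt with h0 | hpos
    · refine ih _ ?_ (T := R.orth β) (J := {α ∈ J ∩ C | ⟪α, β⟫_ℝ = 0}) (fun α hα => hJC hα.1)
        (IsHighest.orth_eq R hJC (hCJ ▸ hβ)) (fun C' β' hC' hβ' => hnode.child hC' hβ')
        ⟨hnode.sub_eq.symm ▸ hψC, h0.symm⟩ rfl
      rw [← hn]
      refine Set.ncard_lt_ncard ((Set.ssubset_iff_of_subset (hnode.orth_subset.trans hC.1)).mpr
        ⟨β, hC.1 hβ.1, hnode.notMem_orth⟩) hTfin
    · exact ⟨T, C, β, hnode, hψC, hpos⟩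

theorem exists_cascade_partner {ψ : V} (hψ : ψ ∈ R.Pos) (hnot : ψ ∉ R.cascade) :
    ∃ ψ' ∈ R.Pos, ψ' ∉ R.cascade ∧ ∃ β ∈ R.cascade, β = ψ + ψ' := by
  obtain ⟨S, C, β, hnode, hψC, hpos⟩ := exists_node_inner_pos subset_rfl R.levi_simple.symm
    (fun C β hC hβ => .root hC hβ) (R.mem_of_pos hψ) hψ
  have hβ : β ∈ R.cascade := mem_cascade_iff.mpr ⟨S, C, hnode⟩
  have hmem := IsHighest.sub_mem_pos R hnode.isHighest hψC hψ hpos fun h => hnot (h ▸ hβ)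
  exact ⟨β - ψ, hmem, fun h => cascade_add_ne h hβ hψ (by abel), β, hβ, by abel⟩

theorem linearIndependent_cascade :
    LinearIndependent ℝ fun β : R.cascade => (β : V) :=
  linearIndependent_of_ne_zero_of_inner_eq_zero
    (fun β => R.ne_zero_of_mem (R.mem_of_pos (pos_of_mem_cascade β.2)))
    fun β β' hne => inner_eq_zero_of_mem_cascade β.2 β'.2 (Subtype.coe_injective.ne hne)

end RootSystemData

/-! ### The cascade acting on the symmetric algebra -/

section torus

open MvPolynomial

theorem derivation_monomial_of_X {P : Type*}
    (D : Derivation ℂ (MvPolynomial P ℂ) (MvPolynomial P ℂ))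
    (a : P → ℂ) (hD : ∀ φ, D (X φ) = a φ • X φ) (d : P →₀ ℕ) (c : ℂ) :
    D (monomial d c) = (Finsupp.weight a d) • monomial d c := by
  have hone : D (monomial d (1 : ℂ)) = Finsupp.weight a d • monomial d (1 : ℂ) := by
    induction d using Finsupp.induction_linear with
    | zero => simp
    | add d e hd he =>
      have hmul : monomial (d + e) (1 : ℂ) = monomial d 1 * monomial e 1 := by
        rw [monomial_mul, one_mul]
      rw [hmul, D.leibniz, hd, he, map_add, add_smul]
      simp only [smul_eq_mul, mul_smul_comm]
      rw [mul_comm (monomial e (1 : ℂ)), add_comm]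
    | single φ n =>
      rw [← X_pow_eq_monomial, D.leibniz_pow, hD, Finsupp.weight_single]
      rcases n with _ | n
      · simp
      · simp only [Nat.add_sub_cancel, smul_eq_mul, mul_smul_comm, ← pow_succ, ← smul_assoc]
  have hc : monomial d c = c • monomial d (1 : ℂ) := by rw [smul_monomial, smul_eq_mul, mul_one]
  rw [hc, D.map_smul, hone, smul_comm]

theorem coeff_derivation_of_X {P : Type*} (D : Derivation ℂ (MvPolynomial P ℂ) (MvPolynomial P ℂ))
    (a : P → ℂ) (hD : ∀ φ, D (X φ) = a φ • X φ) (f : MvPolynomial P ℂ) (d : P →₀ ℕ) :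
    coeff d (D f) = Finsupp.weight a d * coeff d f := by
  classical
  induction f using MvPolynomial.induction_on' with
  | monomial e c =>
    rw [derivation_monomial_of_X D a hD, coeff_smul, smul_eq_mul, coeff_monomial]
    split_ifs with h
    · rw [h]
    · simp
  | add f g hf hg => rw [map_add, coeff_add, coeff_add, hf, hg, mul_add]

end torus

namespace CascadeLieData

open MvPolynomial

variable {V : Type*} [NormedAddCommGroup V] [InnerProductSpace ℝ V]
  {L : Type*} [LieRing L] [LieAlgebra ℂ L]
  (C : CascadeLieData V L)

theorem e_mem_nSub (φ : ↥C.Pos) : C.e φ ∈ C.nSub :=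
  Submodule.subset_span ⟨φ, φ.2, rfl⟩

theorem bracket_of_add (φ ψ χ : ↥C.Pos) (h : (χ : V) = φ + ψ) :
    ∃ c : ℂ, c ≠ 0 ∧ ⁅C.e φ, C.e ψ⁆ = c • C.e χ := by
  rw [h]
  exact C.bracket_add _ (C.pos_subset φ.2) _ (C.pos_subset ψ.2) (h ▸ C.pos_subset χ.2)

theorem bracket_eq_zero (φ ψ : ↥C.Pos) (h : ∀ χ : ↥C.Pos, (χ : V) ≠ φ + ψ) :
    ⁅C.e φ, C.e ψ⁆ = 0 := by
  refine C.bracket_zero _ (C.pos_subset φ.2) _ (C.pos_subset ψ.2)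
    (fun hmem => h ⟨_, C.pos_add _ φ.2 _ ψ.2 hmem⟩ rfl) fun h0 => ?_
  obtain ⟨ℓ, hℓ⟩ := C.toRootSystemData.exists_height
  have := congrArg ℓ h0
  rw [map_add, map_zero] at this
  linarith [hℓ _ φ.2, hℓ _ ψ.2]

theorem exists_bracket_eq (φ ψ : ↥C.Pos) :
    ∃ (c : ℂ) (χ : ↥C.Pos), (c = 0 ∨ (χ : V) = φ + ψ) ∧ ⁅C.e φ, C.e ψ⁆ = c • C.e χ := by
  by_cases h : ∃ χ : ↥C.Pos, (χ : V) = φ + ψ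
  · obtain ⟨χ, hχ⟩ := h
    obtain ⟨c, -, hc⟩ := C.bracket_of_add φ ψ χ hχ
    exact ⟨c, χ, Or.inr hχ, hc⟩
  · exact ⟨0, φ, Or.inl rfl, by rw [C.bracket_eq_zero φ ψ (not_exists.mp h), zero_smul]⟩

variable {C} {ι : L →ₗ[ℂ] MvPolynomial (↥C.Pos) ℂ}
  {Dn : L → Derivation ℂ (MvPolynomial (↥C.Pos) ℂ) (MvPolynomial (↥C.Pos) ℂ)}
  {Dh : C.H → Derivation ℂ (MvPolynomial (↥C.Pos) ℂ) (MvPolynomial (↥C.Pos) ℂ)}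

theorem commutator_apply_of_bracket (hι : ∀ φ : ↥C.Pos, ι (C.e φ) = X φ)
    (hDn : ∀ v ∈ C.nSub, ∀ w ∈ C.nSub, Dn v (ι w) = ι ⁅v, w⁆) {φ ψ χ : ↥C.Pos} {c : ℂ}
    (h : ⁅C.e φ, C.e ψ⁆ = c • C.e χ) (f : MvPolynomial (↥C.Pos) ℂ) :
    Dn (C.e φ) (Dn (C.e ψ) f) = Dn (C.e ψ) (Dn (C.e φ) f) + c • Dn (C.e χ) f := by
  have hmem : ∀ θ η : ↥C.Pos, ⁅C.e θ, C.e η⁆ ∈ C.nSub := fun θ η => by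
    obtain ⟨a, κ, -, h⟩ := C.exists_bracket_eq θ η
    exact h ▸ C.nSub.smul_mem a (C.e_mem_nSub κ)
  have key : ⁅Dn (C.e φ), Dn (C.e ψ)⁆ = c • Dn (C.e χ) := derivation_ext fun θ => by
    rw [Derivation.commutator_apply, Derivation.smul_apply, ← hι,
      hDn _ (C.e_mem_nSub _) _ (C.e_mem_nSub _), hDn _ (C.e_mem_nSub _) _ (hmem _ _),
      hDn _ (C.e_mem_nSub _) _ (C.e_mem_nSub _), hDn _ (C.e_mem_nSub _) _ (hmem _ _),
      hDn _ (C.e_mem_nSub _) _ (C.e_mem_nSub _), ← map_sub, ← map_smul, ← smul_lie, ← h, lie_lie]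
  have := congrArg (fun D => D f) key
  simp only [Derivation.commutator_apply, Derivation.smul_apply] at this
  rw [← this]
  abel

theorem cascadeAction (hι : ∀ φ : ↥C.Pos, ι (C.e φ) = X φ)
    (hDn : ∀ v ∈ C.nSub, ∀ w ∈ C.nSub, Dn v (ι w) = ι ⁅v, w⁆) :
    CascadeAction (Subtype.val : ↥C.Pos → V) (fun φ => Dn (C.e φ))
      {φ | (φ : V) ∈ C.toRootSystemData.cascade} where
  height := by
    obtain ⟨ℓ, hℓ⟩ := C.toRootSystemData.exists_height
    exact ⟨ℓ, fun φ => hℓ _ φ.2⟩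
  weight_injective := Subtype.val_injective
  apply_X_of_add φ ψ χ h := by
    obtain ⟨c, hc, hbr⟩ := C.bracket_of_add φ ψ χ h
    exact ⟨c, hc, by rw [← hι, hDn _ (C.e_mem_nSub _) _ (C.e_mem_nSub _), hbr, map_smul, hι]⟩
  apply_X_eq_zero φ ψ h := by
    rw [← hι, hDn _ (C.e_mem_nSub _) _ (C.e_mem_nSub _), C.bracket_eq_zero φ ψ h, map_zero]
  commutator φ ψ := by
    obtain ⟨c, χ, h, hbr⟩ := C.exists_bracket_eq φ ψ
    exact ⟨c, χ, h, commutator_apply_of_bracket hι hDn hbr⟩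
  partner ψ hψ := by
    obtain ⟨ψ', hψ', hnot, β, hβ, h⟩ := RootSystemData.exists_cascade_partner ψ.2 hψ
    exact ⟨⟨ψ', hψ'⟩, hnot, ⟨β, RootSystemData.pos_of_mem_cascade hβ⟩, hβ, h⟩
  partner_unique ψ χ χ' β β' hβ hβ' h h' :=
    Subtype.ext (RootSystemData.cascade_partner_unique ψ.2 χ.2 χ'.2 hβ hβ' h h')
  add_ne β hβ φ β' hβ' := RootSystemData.cascade_add_ne hβ hβ' φ.2
  weight_indep :=
    (RootSystemData.linearIndependent_cascade (R := C.toRootSystemData)).comp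
      (fun β : {φ : ↥C.Pos | (φ : V) ∈ C.toRootSystemData.cascade} => ⟨β.1, β.2⟩)
      fun β β' h => Subtype.ext (Subtype.ext (Subtype.mk.inj h))

theorem mem_killedBy_univ_iff (hι : ∀ φ : ↥C.Pos, ι (C.e φ) = X φ)
    (hDn : ∀ v ∈ C.nSub, ∀ w ∈ C.nSub, Dn v (ι w) = ι ⁅v, w⁆) {f : MvPolynomial (↥C.Pos) ℂ} :
    f ∈ killedBy (fun φ : ↥C.Pos => Dn (C.e φ)) Set.univ ↔ ∀ v ∈ C.nSub, Dn v f = 0 := by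
  rw [mem_killedBy]
  refine ⟨fun h v hv => ?_, fun h φ _ => h _ (C.e_mem_nSub φ)⟩
  induction hv using Submodule.span_induction with
  | mem v hv =>
    obtain ⟨φ, hφ, rfl⟩ := hv
    exact h ⟨φ, hφ⟩ trivial
  | zero =>
    have : Dn 0 = 0 := derivation_ext fun θ => by
      rw [← hι, hDn _ C.nSub.zero_mem _ (C.e_mem_nSub _), zero_lie, map_zero,
        Derivation.zero_apply]
    rw [this, Derivation.zero_apply]
  | add u v hu hv ihu ihv =>
    have : Dn (u + v) = Dn u + Dn v := derivation_ext fun θ => by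
      rw [Derivation.add_apply, ← hι, hDn _ (C.nSub.add_mem hu hv) _ (C.e_mem_nSub _),
        hDn _ hu _ (C.e_mem_nSub _), hDn _ hv _ (C.e_mem_nSub _), add_lie, map_add]
    rw [this, Derivation.add_apply, ihu, ihv, add_zero]
  | smul a v hv ih =>
    have : Dn (a • v) = a • Dn v := derivation_ext fun θ => by
      rw [Derivation.smul_apply, ← hι, hDn _ (C.nSub.smul_mem a hv) _ (C.e_mem_nSub _),
        hDn _ hv _ (C.e_mem_nSub _), smul_lie, map_smul]
    rw [this, Derivation.smul_apply, ih, smul_zero]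

theorem isWeightedHomogeneous_iff (hι : ∀ φ : ↥C.Pos, ι (C.e φ) = X φ)
    (hDh : ∀ x : C.H, ∀ w ∈ C.nSub, Dh x (ι w) = ι ⁅(x : L), w⁆) {ν : V}
    {f : MvPolynomial (↥C.Pos) ℂ} :
    IsWeightedHomogeneous (Subtype.val : ↥C.Pos → V) f ν ↔
      ∀ x : C.H, Dh x f = C.wt ν x • f := by
  have hX : ∀ (x : C.H) (φ : ↥C.Pos), Dh x (X φ) = C.wt φ x • X φ := fun x φ => by
    rw [← hι, hDh x _ (C.e_mem_nSub _), C.root_vec x _ (C.pos_subset φ.2), map_smul]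
  have hweight : ∀ (x : C.H) (d : ↥C.Pos →₀ ℕ),
      Finsupp.weight (fun φ : ↥C.Pos => C.wt φ x) d = C.wt (Finsupp.weight Subtype.val d) x := by
    intro x d
    simp only [Finsupp.weight_apply, Finsupp.sum, map_sum, map_nsmul, LinearMap.sum_apply,
      LinearMap.smul_apply]
  have hcoeff : ∀ (x : C.H) (d : ↥C.Pos →₀ ℕ),
      coeff d (Dh x f) = C.wt (Finsupp.weight Subtype.val d) x * coeff d f := fun x d => by
    rw [coeff_derivation_of_X (Dh x) _ (hX x), hweight]
  constructor
  · intro h x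
    ext d
    rw [hcoeff, coeff_smul, smul_eq_mul]
    by_cases hd : coeff d f = 0
    · rw [hd, mul_zero, mul_zero]
    · rw [h hd]
  · intro h d hd
    refine C.wt_inj (LinearMap.ext fun x => mul_right_cancel₀ hd ?_)
    rw [← hcoeff, h x, coeff_smul, smul_eq_mul]

end CascadeLieData

/-! ### Polynomial generators indexed by `Fin m` -/

section primeInvariant

open MvPolynomial

theorem restrictVars_prod_primeInvariant {P I : Type*} {B : Set P}
    {D : P → Derivation ℂ (MvPolynomial P ℂ) (MvPolynomial P ℂ)} [Fintype I]
    (e : I → primeExponents D B) (d : I → ℕ) :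
    restrictVars B (∏ i, primeInvariant (e i) ^ d i) =
      monomial (∑ i, d i • (e i : B →₀ ℕ)) 1 := by
  rw [map_prod, monomial_sum_one]
  refine Finset.prod_congr rfl fun i _ => ?_
  rw [map_pow, restrictVars_primeInvariant, monomial_pow, one_pow]

end primeInvariant

namespace CascadeAction

open MvPolynomial

variable {P V : Type*} [Fintype P] [AddCommGroup V] [Module ℝ V] {w : P → V}
  {D : P → Derivation ℂ (MvPolynomial P ℂ) (MvPolynomial P ℂ)} {B : Set P}

theorem exists_restrict_eq_monomial (h : CascadeAction w D B) {f : MvPolynomial P ℂ} {ν : V}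
    (hf : f ∈ killedBy D Set.univ) (hν : IsWeightedHomogeneous w f ν) (hf0 : f ≠ 0) :
    ∃ d c, c ≠ 0 ∧ restrictVars B f = monomial d c := by
  obtain ⟨d, c, hdc⟩ := h.restrict_eq_monomial hν
  refine ⟨d, c, fun hc => hf0 (h.eq_zero_of_restrict_eq_zero hf ?_), hdc⟩
  rw [hdc, hc, monomial_zero]

theorem existsUnique_eq_smul_prod (h : CascadeAction w D B) {I : Type*} [Fintype I]
    (e : I ≃ primeExponents D B) {f : MvPolynomial P ℂ} {ν : V} (hf : f ∈ killedBy D Set.univ)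
    (hν : IsWeightedHomogeneous w f ν) (hf0 : f ≠ 0) :
    ∃! d : I → ℕ, ∃ c : ℂ, c ≠ 0 ∧ f = c • ∏ i, primeInvariant (e i) ^ d i := by
  classical
  obtain ⟨d, c, hc, hdc⟩ := h.exists_restrict_eq_monomial hf hν hf0
  obtain ⟨s, a, ha, hfs⟩ := h.exists_eq_smul_prod hf hc hdc
  have hfd : f = a • ∏ i, primeInvariant (e i) ^ s.count (e i) := by
    have : Fintype (primeExponents D B) := Fintype.ofEquiv I e
    rw [hfs, Finset.prod_multiset_map_count, e.prod_comp fun d => primeInvariant d ^ s.count d]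
    congr 1
    refine Finset.prod_subset (Finset.subset_univ _) fun d _ hd => ?_
    rw [Multiset.count_eq_zero_of_notMem fun hmem => hd (Multiset.mem_toFinset.mpr hmem),
      pow_zero]
  refine ⟨fun i => s.count (e i), ⟨a, ha, hfd⟩, ?_⟩
  rintro d' ⟨c', hc', hfd'⟩
  have heq := congrArg (restrictVars B) (hfd'.symm.trans hfd)
  simp only [map_smul, restrictVars_prod_primeInvariant, smul_monomial, smul_eq_mul,
    mul_one] at heq
  have hsum := ((monomial_eq_monomial_iff _ _ _ _).mp heq).resolve_right fun h0 => hc' h0.1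
  exact funext (Fintype.linearIndependent_iffₛ.mp
    (h.linearIndependent_primeExponents.comp e e.injective) _ _ hsum.1)

theorem exists_polynomial_generators (h : CascadeAction w D B) {m : ℕ}
    (hm : Nat.card (primeExponents D B) = m) :
    ∃ (μ : Fin m → V) (ξ : Fin m → MvPolynomial P ℂ),
      (∀ i, ξ i ∈ killedBy D Set.univ ∧ IsWeightedHomogeneous w (ξ i) (μ i) ∧ Prime (ξ i)) ∧
      (∀ (ν : V) (f : MvPolynomial P ℂ), f ∈ killedBy D Set.univ → IsWeightedHomogeneous w f ν →
        Prime f → ∃ i, ν = μ i ∧ ∃ c : ℂ, f = c • ξ i) ∧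
      LinearIndependent ℝ μ ∧
      AlgebraicIndependent ℂ ξ ∧
      (∀ f : MvPolynomial P ℂ, f ∈ killedBy D Set.univ ↔ f ∈ Algebra.adjoin ℂ (Set.range ξ)) ∧
      (∀ (ν : V) (f : MvPolynomial P ℂ), f ∈ killedBy D Set.univ → IsWeightedHomogeneous w f ν →
        f ≠ 0 → ∃! d : Fin m → ℕ, ∃ c : ℂ, c ≠ 0 ∧ f = c • ∏ i, ξ i ^ d i) ∧
      (∀ d : Fin m → ℕ, ∃ (ν : V) (f : MvPolynomial P ℂ), f ∈ killedBy D Set.univ ∧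
        IsWeightedHomogeneous w f ν ∧ f ≠ 0 ∧ ∃ c : ℂ, c ≠ 0 ∧ f = c • ∏ i, ξ i ^ d i) := by
  classical
  have := h.finite_primeExponents
  obtain ⟨e⟩ : Nonempty (Fin m ≃ primeExponents D B) := ⟨(Finite.equivFinOfCardEq hm).symm⟩
  have hhom : ∀ d : primeExponents D B, IsWeightedHomogeneous w (primeInvariant d)
      (Finsupp.weight (fun β : B => w β) d) := fun d =>
    h.isWeightedHomogeneous_of_restrict (primeInvariant_mem d) (restrictVars_primeInvariant d)
  have hindep : LinearIndependent ℝ fun i => Finsupp.weight (fun β : B => w β) (e i : B →₀ ℕ) :=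
    h.linearIndependent_weight_primeExponents.comp e e.injective
  refine ⟨fun i => Finsupp.weight (fun β : B => w β) (e i : B →₀ ℕ), fun i => primeInvariant (e i),
    fun i => ⟨primeInvariant_mem _, hhom _, prime_primeInvariant _⟩, fun ν f hf hν hprime => ?_,
    hindep,
    h.algebraicIndependent_primeInvariant.comp e e.injective, fun f => ?_,
    fun ν f hf hν hf0 => ?_, fun d => ?_⟩
  · obtain ⟨d, c, hc, hdc⟩ := h.exists_restrict_eq_monomial hf hν hprime.ne_zero
    obtain ⟨d, rfl, hfd⟩ := h.exists_eq_smul_primeInvariant hprime hf hc hdc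
    obtain ⟨i, rfl⟩ := e.surjective d
    refine ⟨i, ?_, c, hfd⟩
    exact hν.inj_right hprime.ne_zero (h.isWeightedHomogeneous_of_restrict hf hdc)
  · rw [h.killedBy_univ_eq_adjoin, ← e.surjective.range_comp]
    rfl
  · exact h.existsUnique_eq_smul_prod e hf hν hf0
  · have hρ := restrictVars_prod_primeInvariant (fun i => e i) d
    have hmem : ∏ i, primeInvariant (e i) ^ d i ∈ killedBy D Set.univ :=
      prod_mem fun i _ => pow_mem (primeInvariant_mem _) _
    refine ⟨_, _, hmem, h.isWeightedHomogeneous_of_restrict hmem hρ,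
      Finset.prod_ne_zero_iff.mpr fun i _ => pow_ne_zero _ (prime_primeInvariant _).ne_zero,
      1, one_ne_zero, (one_smul _ _).symm⟩

end CascadeAction

/-- With `S(𝔫)` realized as the polynomial ring on `{e_φ : φ ∈ Δ₊}` and
with the `𝔫`- and `𝔥`-actions by derivations as above, let `m = card ℬ`.  There are exactly
`m` weights `μ₁,…,μ_m` whose weight vectors `ξ_{μ₁},…,ξ_{μ_m} ∈ S(𝔫)^𝔫` are prime; the
`μᵢ` are linearly independent; the `ξ_{μᵢ}` are algebraically independent and generate
`S(𝔫)^𝔫 = ℂ[ξ_{μ₁},…,ξ_{μ_m}]` as a polynomial ring; and `ν ↦ (d₁(ν),…,d_m(ν))` is a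
bijection from the weights of `S(𝔫)^𝔫` onto `ℕ^m`, with the weight vector of weight `ν`
equal (up to a nonzero scalar) to `ξ_{μ₁}^{d₁(ν)} ⋯ ξ_{μ_m}^{d_m(ν)}`, its prime
factorization. -/
theorem statement18 {V : Type*} [NormedAddCommGroup V] [InnerProductSpace ℝ V]
    {L : Type*} [LieRing L] [LieAlgebra ℂ L] [Module.Finite ℂ L]
    (C : CascadeLieData V L)
    (ι : L →ₗ[ℂ] MvPolynomial (↥C.Pos) ℂ)
    (hι : ∀ φ : ↥C.Pos, ι (C.e φ) = MvPolynomial.X φ)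
    (Dn : L → Derivation ℂ (MvPolynomial (↥C.Pos) ℂ) (MvPolynomial (↥C.Pos) ℂ))
    (hDn : ∀ v ∈ C.nSub, ∀ w ∈ C.nSub, Dn v (ι w) = ι ⁅v, w⁆)
    (Dh : C.H → Derivation ℂ (MvPolynomial (↥C.Pos) ℂ) (MvPolynomial (↥C.Pos) ℂ))
    (hDh : ∀ x : C.H, ∀ w ∈ C.nSub, Dh x (ι w) = ι ⁅(x : L), w⁆)
    (m : ℕ) (hm : m = (C.toRootSystemData.cascade).ncard) :
    ∃ (μ : Fin m → V) (ξ : Fin m → MvPolynomial (↥C.Pos) ℂ),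
      (∀ i, (∀ v ∈ C.nSub, Dn v (ξ i) = 0) ∧
        (∀ x : C.H, Dh x (ξ i) = C.wt (μ i) x • ξ i) ∧ Prime (ξ i)) ∧
      (∀ (ν : V) (f : MvPolynomial (↥C.Pos) ℂ), (∀ v ∈ C.nSub, Dn v f = 0) →
        (∀ x : C.H, Dh x f = C.wt ν x • f) → Prime f →
        ∃ i, ν = μ i ∧ ∃ c : ℂ, f = c • ξ i) ∧
      LinearIndependent ℝ μ ∧
      AlgebraicIndependent ℂ ξ ∧
      (∀ f : MvPolynomial (↥C.Pos) ℂ,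
        (∀ v ∈ C.nSub, Dn v f = 0) ↔ f ∈ Algebra.adjoin ℂ (Set.range ξ)) ∧
      (∀ (ν : V) (f : MvPolynomial (↥C.Pos) ℂ), (∀ v ∈ C.nSub, Dn v f = 0) →
        (∀ x : C.H, Dh x f = C.wt ν x • f) → f ≠ 0 →
        ∃! d : Fin m → ℕ, ∃ c : ℂ, c ≠ 0 ∧ f = c • ∏ i, ξ i ^ d i) ∧
      (∀ d : Fin m → ℕ, ∃ (ν : V) (f : MvPolynomial (↥C.Pos) ℂ),
        (∀ v ∈ C.nSub, Dn v f = 0) ∧ (∀ x : C.H, Dh x f = C.wt ν x • f) ∧ f ≠ 0 ∧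
        ∃ c : ℂ, c ≠ 0 ∧ f = c • ∏ i, ξ i ^ d i) := by
  classical
  have : Fintype ↥C.Pos := C.toRootSystemData.finite_pos.fintype
  set D : ↥C.Pos → Derivation ℂ (MvPolynomial (↥C.Pos) ℂ) (MvPolynomial (↥C.Pos) ℂ) :=
    fun φ => Dn (C.e φ) with hD
  set B : Set ↥C.Pos := {φ | (φ : V) ∈ C.toRootSystemData.cascade} with hB
  have hact : CascadeAction (Subtype.val : ↥C.Pos → V) D B := CascadeLieData.cascadeAction hι hDn
  have hinv : ∀ f : MvPolynomial (↥C.Pos) ℂ,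
      (∀ v ∈ C.nSub, Dn v f = 0) ↔ f ∈ killedBy D Set.univ := fun f =>
    (CascadeLieData.mem_killedBy_univ_iff hι hDn).symm
  have hhom : ∀ (ν : V) (f : MvPolynomial (↥C.Pos) ℂ), (∀ x : C.H, Dh x f = C.wt ν x • f) ↔
      MvPolynomial.IsWeightedHomogeneous Subtype.val f ν := fun ν f =>
    (CascadeLieData.isWeightedHomogeneous_iff hι hDh).symm
  have hcard : Nat.card (primeExponents D B) = m := by
    rw [hact.card_primeExponents, hm, ← Nat.card_coe_set_eq]
    exact Nat.card_congr
      { toFun := fun β => ⟨β.1, β.2⟩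
        invFun := fun β => ⟨⟨β, RootSystemData.pos_of_mem_cascade β.2⟩, β.2⟩ }
  have := hact.finite_primeExponents
  simp only [hinv, hhom]
  exact hact.exists_polynomial_generators hcard
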